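/- Fix τ ∈ (0,T] and an initial state x̄ ∈ ℝⁿ, and assume h Var[A_R] ≤ 1 and sup_{t ∈ [0,T]} ‖P_T(t)‖ ≤ κ. For each ω, let x*(ω,·) solve ẋ*(ω,t) = (A_R(ω,t) − BW⁻¹BᵀP_R(ω,t))x*(ω,t) on [0,T] with x*(ω,0) = x̄, let y(ω,·) solve ẏ(ω,t) = Ay(ω,t) − BW⁻¹BᵀP_R(ω,t)x*(ω,t) with y(ω,0) = x̄, and define g(ω,t) := W⁻¹BᵀP_T(t)y(ω,t) − W⁻¹BᵀP_R(ω,t)x*(ω,t). Then there exists a constant C_T > 0, depending only on A, B, Q, W, F, T, and κ, such that for all t ∈ [0,τ], E[|g(·,t)|] ≤ C_T e^{μ_R(2T+τ)} √(h Var[A_R]) |x̄|. -/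

import Mathlib

open MeasureTheory Matrix Set

attribute [local instance] Matrix.frobeniusNormedAddCommGroup Matrix.frobeniusNormedSpace

noncomputable section

/-- The Euclidean norm of a vector in `Fin n → ℝ`. -/
def eN {n : ℕ} (x : Fin n → ℝ) : ℝ := Real.sqrt (∑ i, x i ^ 2)

/-- The continuous linear map on Euclidean space induced by a matrix. -/
def clm {n r : ℕ} (A : Matrix (Fin n) (Fin r) ℝ) :
    EuclideanSpace ℝ (Fin r) →L[ℝ] EuclideanSpace ℝ (Fin n) :=
  LinearMap.toContinuousLinearMap (Matrix.toEuclideanLin A)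

/-- The operator norm of a matrix induced by the Euclidean norms. -/
def opN {n r : ℕ} (A : Matrix (Fin n) (Fin r) ℝ) : ℝ := ‖clm A‖

/-- The seminorm `|x|_M = √(xᵀ M x)` associated to a positive semidefinite matrix `M`. -/
def qN {n : ℕ} (M : Matrix (Fin n) (Fin n) ℝ) (x : Fin n → ℝ) : ℝ :=
  Real.sqrt (x ⬝ᵥ (M *ᵥ x))

/-- The `L²(a,b;ℝ^m)`-norm of a control. -/
def l2N {m : ℕ} (u : ℝ → Fin m → ℝ) (a b : ℝ) : ℝ :=
  Real.sqrt (∫ s in a..b, (eN (u s)) ^ 2)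

/-- The probability `π_m` that the index `m` is contained in the selected subset. -/
def piP {M : ℕ} (S : Fin (2 ^ M) → Finset (Fin M)) (p : Fin (2 ^ M) → ℝ) (m : Fin M) : ℝ :=
  ∑ ω ∈ Finset.univ.filter (fun ω => m ∈ S ω), p ω

/-- The random batch matrix `Σ_{m ∈ S_ω} A_m / π_m` associated to a subset index `ω`. -/
def batchM {n M : ℕ} (As : Fin M → Matrix (Fin n) (Fin n) ℝ)
    (S : Fin (2 ^ M) → Finset (Fin M)) (p : Fin (2 ^ M) → ℝ) (ω : Fin (2 ^ M)) :
    Matrix (Fin n) (Fin n) ℝ :=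
  ∑ m ∈ S ω, (piP S p m)⁻¹ • As m

/-- The piecewise constant randomized matrix `A_R(ω,t)`, equal to `Σ_{m ∈ S_{ω_k}} A_m/π_m`
for `t ∈ [(k-1)h, kh)`. -/
def AR {n M K : ℕ} (As : Fin M → Matrix (Fin n) (Fin n) ℝ)
    (S : Fin (2 ^ M) → Finset (Fin M)) (p : Fin (2 ^ M) → ℝ) (h : ℝ)
    (ω : Fin K → Fin (2 ^ M)) (t : ℝ) : Matrix (Fin n) (Fin n) ℝ :=
  if hK : 0 < K then
    batchM As S p (ω ⟨min ⌊t / h⌋₊ (K - 1),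
      Nat.lt_of_le_of_lt (min_le_right _ _) (Nat.sub_lt hK one_pos)⟩)
  else 0

/-- The variance `Var[A_R] = Σ_ω p_ω ‖A − Σ_{m ∈ S_ω} A_m/π_m‖²`. -/
def varAR {n M : ℕ} (A : Matrix (Fin n) (Fin n) ℝ) (As : Fin M → Matrix (Fin n) (Fin n) ℝ)
    (S : Fin (2 ^ M) → Finset (Fin M)) (p : Fin (2 ^ M) → ℝ) : ℝ :=
  ∑ ω : Fin (2 ^ M), p ω * (opN (A - batchM As S p ω)) ^ 2

/-- Expectation of a random variable depending on `ω = (ω_1,…,ω_K)`. -/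
def expec {M K : ℕ} (p : Fin (2 ^ M) → ℝ) (X : (Fin K → Fin (2 ^ M)) → ℝ) : ℝ :=
  ∑ ω : Fin K → Fin (2 ^ M), (∏ k, p (ω k)) * X ω

/-- Expectation of a random variable depending on a sequence `(ω_1, ω_2, …)` of batch draws
through its first `i` entries only. -/
def expecSeq {M K : ℕ} (p : Fin (2 ^ M) → ℝ) (i : ℕ)
    (X : (ℕ → Fin K → Fin (2 ^ M)) → ℝ) : ℝ :=
  ∑ Ω : Fin i → Fin K → Fin (2 ^ M), (∏ j, ∏ k, p (Ω j k)) *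
    X (fun j => if hj : j < i then Ω ⟨j, hj⟩ else fun _ => ⟨0, Nat.two_pow_pos M⟩)

end

open MeasureTheory Matrix Set
namespace FB
set_option linter.unusedSectionVars false

section ops
variable {E : Type*} [NormedAddCommGroup E] [InnerProductSpace ℝ E] [CompleteSpace E]

/-- operator exponential `e^{ta}` -/
noncomputable def ex (a : E →L[ℝ] E) (t : ℝ) : E →L[ℝ] E := NormedSpace.exp (t • a)

lemma ex_zero (a : E →L[ℝ] E) : ex a 0 = 1 := by simp [ex, NormedSpace.exp_zero]

lemma ex_add (a : E →L[ℝ] E) (x y : ℝ) : ex a (x + y) = ex a x * ex a y := by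
  let _ : NormedAlgebra ℚ (E →L[ℝ] E) := NormedAlgebra.restrictScalars ℚ ℝ _
  unfold ex
  rw [add_smul]
  exact NormedSpace.exp_add_of_commute (((Commute.refl a).smul_left x).smul_right y)

lemma ex_deriv (a : E →L[ℝ] E) (t : ℝ) : HasDerivAt (ex a) (ex a t * a) t :=
  hasDerivAt_exp_smul_const a t

lemma ex_deriv' (a : E →L[ℝ] E) (t : ℝ) : HasDerivAt (ex a) (a * ex a t) t :=
  hasDerivAt_exp_smul_const' a t

lemma ex_cont (a : E →L[ℝ] E) : Continuous (ex a) :=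
  continuous_iff_continuousAt.2 fun t => (ex_deriv a t).continuousAt

lemma ex_norm_le {a : E →L[ℝ] E} {μ : ℝ} (hμ : ∀ x, inner ℝ (a x) x ≤ μ * ‖x‖ ^ 2)
    {t : ℝ} (ht : 0 ≤ t) : ‖ex a t‖ ≤ Real.exp (μ * t) := by
  refine ContinuousLinearMap.opNorm_le_bound _ (Real.exp_pos _).le fun v => ?_
  have hd : ∀ s, HasDerivAt (fun s => Real.exp (-(2 * μ) * s) * inner ℝ (ex a s v) (ex a s v))
      (Real.exp (-(2 * μ) * s) * (-(2 * μ)) * inner ℝ (ex a s v) (ex a s v) +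
       Real.exp (-(2 * μ) * s) * (inner ℝ (ex a s v) (a (ex a s v)) +
        inner ℝ (a (ex a s v)) (ex a s v))) s := by
    intro s
    have h1 : HasDerivAt (fun s => ex a s v) (a (ex a s v)) s := by
      have := (ex_deriv' a s).clm_apply (hasDerivAt_const s v)
      simpa using this
    have h2 : HasDerivAt (fun s => Real.exp (-(2 * μ) * s)) (Real.exp (-(2 * μ) * s) * (-(2 * μ))) s := by
      have := ((hasDerivAt_id s).const_mul (-(2 * μ))).exp
      simpa using this
    exact h2.mul (h1.inner ℝ h1)
  have hanti : Antitone (fun s => Real.exp (-(2 * μ) * s) * inner ℝ (ex a s v) (ex a s v)) := by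
    apply antitone_of_deriv_nonpos
    · intro s; exact (hd s).differentiableAt
    · intro s
      rw [(hd s).deriv]
      have := hμ (ex a s v)
      rw [real_inner_comm (a _), real_inner_self_eq_norm_sq]
      have he := Real.exp_pos (-(2 * μ) * s)
      nlinarith
  have h0 := hanti ht
  simp only [ex_zero, real_inner_self_eq_norm_sq, mul_zero, Real.exp_zero, one_mul,
    one_apply_eq_self] at h0
  have h3 : ‖ex a t v‖ ^ 2 ≤ (Real.exp (μ * t) * ‖v‖) ^ 2 := by
    have : Real.exp (μ * t) ^ 2 * Real.exp (-(2 * μ) * t) = 1 := by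
      rw [← Real.exp_nat_mul, ← Real.exp_add]; simp; ring
    calc ‖ex a t v‖ ^ 2 = Real.exp (μ * t) ^ 2 * (Real.exp (-(2 * μ) * t) * ‖ex a t v‖ ^ 2) := by
          rw [← mul_assoc, this, one_mul]
      _ ≤ Real.exp (μ * t) ^ 2 * ‖v‖ ^ 2 := by gcongr
      _ = _ := by ring
  exact le_of_sq_le_sq h3 (by positivity)

lemma inner_le_op (a : E →L[ℝ] E) (x : E) : inner ℝ (a x) x ≤ ‖a‖ * ‖x‖ ^ 2 := by
  calc inner ℝ (a x) x ≤ ‖a x‖ * ‖x‖ := real_inner_le_norm _ _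
    _ ≤ ‖a‖ * ‖x‖ * ‖x‖ := by gcongr; exact a.le_opNorm x
    _ = _ := by ring

lemma ex_norm_le' (a : E →L[ℝ] E) {t : ℝ} (ht : 0 ≤ t) : ‖ex a t‖ ≤ Real.exp (‖a‖ * t) :=
  ex_norm_le (inner_le_op a) ht

lemma duh_deriv (a A : E →L[ℝ] E) (δ s : ℝ) :
    HasDerivAt (fun s => ex a (δ - s) * ex A s) (- (ex a (δ - s) * (a - A) * ex A s)) s := by
  have h1 : HasDerivAt (fun s => ex a (δ - s)) (-(ex a (δ - s) * a)) s := by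
    have := (ex_deriv a (δ - s)).scomp s ((hasDerivAt_id s).const_sub δ)
    simpa [Function.comp_def] using this
  have := h1.mul (ex_deriv' A s)
  have e : - (ex a (δ - s) * (a - A) * ex A s) =
      -(ex a (δ - s) * a) * ex A s + ex a (δ - s) * (A * ex A s) := by noncomm_ring
  rw [e]
  exact this

lemma ex_diff_le {a A : E →L[ℝ] E} {μ : ℝ} (hμ0 : 0 ≤ μ)
    (hμ : ∀ x, inner ℝ (a x) x ≤ μ * ‖x‖ ^ 2) {δ : ℝ} (hδ : 0 ≤ δ) :
    ‖ex a δ - ex A δ‖ ≤ δ * ‖A - a‖ * Real.exp (μ * δ) * Real.exp (‖A‖ * δ) := by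
  have := norm_image_sub_le_of_norm_deriv_le_segment' (a := 0) (b := δ)
    (f := fun s => ex a (δ - s) * ex A s) (f' := fun s => - (ex a (δ - s) * (a - A) * ex A s))
    (C := ‖A - a‖ * Real.exp (μ * δ) * Real.exp (‖A‖ * δ))
    (fun x _ => (duh_deriv a A δ x).hasDerivWithinAt) ?_ δ ⟨hδ, le_rfl⟩
  · simp only [sub_self, ex_zero, one_mul, sub_zero, mul_one] at this
    rw [norm_sub_rev]
    linarith
  · intro s hs
    rw [norm_neg]
    calc ‖ex a (δ - s) * (a - A) * ex A s‖ ≤ ‖ex a (δ - s)‖ * ‖a - A‖ * ‖ex A s‖ :=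
          norm_mul₃_le
      _ ≤ Real.exp (μ * δ) * ‖a - A‖ * Real.exp (‖A‖ * δ) := by
          have h1 : ‖ex a (δ - s)‖ ≤ Real.exp (μ * δ) :=
            (ex_norm_le hμ (by linarith [hs.2])).trans
              (Real.exp_le_exp.2 (mul_le_mul_of_nonneg_left (by linarith [hs.1]) hμ0))
          have h2 : ‖ex A s‖ ≤ Real.exp (‖A‖ * δ) :=
            (ex_norm_le' A hs.1).trans
              (Real.exp_le_exp.2 (mul_le_mul_of_nonneg_left hs.2.le (norm_nonneg _)))
          gcongr
      _ = _ := by rw [norm_sub_rev]; ring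

lemma ex_mean_le {I : Type*} [Fintype I] {p : I → ℝ} (hp : ∀ i, 0 ≤ p i) (hp1 : ∑ i, p i = 1)
    {a : I → E →L[ℝ] E} {A : E →L[ℝ] E} (hA : ∑ i, p i • a i = A) {μ : ℝ} (hμ0 : 0 ≤ μ)
    (hμ : ∀ i x, inner ℝ (a i x) x ≤ μ * ‖x‖ ^ 2) {δ : ℝ} (hδ : 0 ≤ δ) :
    ‖∑ i, p i • (ex (a i) δ - ex A δ)‖ ≤
      δ ^ 2 * (∑ i, p i * ‖A - a i‖ ^ 2) * Real.exp (μ * δ) * Real.exp (‖A‖ * δ) ^ 2 := by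
  have hz : ∑ i, p i • (a i - A) = 0 := by
    simp only [smul_sub, Finset.sum_sub_distrib, ← Finset.sum_smul, hp1, hA, one_smul, sub_self]
  have := norm_image_sub_le_of_norm_deriv_le_segment' (a := 0) (b := δ)
    (f := fun s => ∑ i, p i • (ex (a i) (δ - s) * ex A s))
    (f' := fun s => ∑ i, p i • (- (ex (a i) (δ - s) * (a i - A) * ex A s)))
    (C := δ * (∑ i, p i * ‖A - a i‖ ^ 2) * Real.exp (μ * δ) * Real.exp (‖A‖ * δ) ^ 2)
    (fun x _ => (HasDerivAt.fun_sum fun i _ =>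
      (duh_deriv (a i) A δ x).const_smul (p i)).hasDerivWithinAt) ?_ δ ⟨hδ, le_rfl⟩
  · simp only [sub_self, ex_zero, one_mul, sub_zero, mul_one] at this
    rw [norm_sub_rev, ← Finset.sum_sub_distrib] at this
    simp only [← smul_sub] at this
    linarith
  · intro s hs
    have e1 : ∑ i, p i • (- (ex (a i) (δ - s) * (a i - A) * ex A s)) =
        ∑ i, p i • (- ((ex (a i) (δ - s) - ex A (δ - s)) * (a i - A) * ex A s)) := by
      have : ∑ i, p i • (ex A (δ - s) * (a i - A) * ex A s) = 0 := by
        calc _ = ex A (δ - s) * (∑ i, p i • (a i - A)) * ex A s := by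
              simp only [Finset.mul_sum, Finset.sum_mul, mul_smul_comm, smul_mul_assoc]
          _ = 0 := by rw [hz]; simp
      rw [← add_zero (∑ i, p i • (- (ex (a i) (δ - s) * (a i - A) * ex A s))), ← this,
        ← Finset.sum_add_distrib]
      refine Finset.sum_congr rfl fun i _ => ?_
      rw [← smul_add]; congr 1; noncomm_ring
    show ‖∑ i, p i • (- (ex (a i) (δ - s) * (a i - A) * ex A s))‖ ≤ _
    rw [e1]
    refine (norm_sum_le _ _).trans ?_
    rw [show δ * (∑ i, p i * ‖A - a i‖ ^ 2) * Real.exp (μ * δ) * Real.exp (‖A‖ * δ) ^ 2 =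
      ∑ i, p i * (δ * ‖A - a i‖ * Real.exp (μ * δ) * Real.exp (‖A‖ * δ) * ‖A - a i‖ *
        Real.exp (‖A‖ * δ)) by
        rw [Finset.mul_sum, Finset.sum_mul, Finset.sum_mul]
        exact Finset.sum_congr rfl fun i _ => by ring]
    refine Finset.sum_le_sum fun i _ => ?_
    rw [norm_smul, norm_neg, Real.norm_of_nonneg (hp i)]
    refine mul_le_mul_of_nonneg_left ?_ (hp i)
    have hs1 : 0 ≤ δ - s := by linarith [hs.2]
    have h1 := ex_diff_le (A := A) hμ0 (hμ i) hs1
    have h2 : ‖ex A s‖ ≤ Real.exp (‖A‖ * δ) :=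
      (ex_norm_le' A hs.1).trans
        (Real.exp_le_exp.2 (mul_le_mul_of_nonneg_left hs.2.le (norm_nonneg _)))
    have h3 : (δ - s) * ‖A - a i‖ * Real.exp (μ * (δ - s)) * Real.exp (‖A‖ * (δ - s)) ≤
        δ * ‖A - a i‖ * Real.exp (μ * δ) * Real.exp (‖A‖ * δ) := by
      have : δ - s ≤ δ := by linarith [hs.1]
      gcongr
    calc _ ≤ ‖ex (a i) (δ - s) - ex A (δ - s)‖ * ‖a i - A‖ * ‖ex A s‖ := norm_mul₃_le
      _ ≤ _ := by
        rw [norm_sub_rev (a i) A]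
        have := h1.trans h3
        gcongr

/-- one-step mean-square estimate -/
lemma one_step {I : Type*} [Fintype I] {p : I → ℝ} (hp : ∀ i, 0 ≤ p i) (hp1 : ∑ i, p i = 1)
    {a : I → E →L[ℝ] E} {A : E →L[ℝ] E} (hA : ∑ i, p i • a i = A) {μ : ℝ} (hμ0 : 0 ≤ μ)
    (hμ : ∀ i x, inner ℝ (a i x) x ≤ μ * ‖x‖ ^ 2) {δ T : ℝ} (hδ : 0 ≤ δ) (hδT : δ ≤ T)
    (d x : E) :
    ∑ i, p i * ‖ex (a i) δ d + (ex (a i) δ - ex A δ) x‖ ^ 2 ≤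
      Real.exp (2 * μ * δ) * (‖d‖ ^ 2 + 3 * Real.exp (‖A‖ * T) ^ 3 *
        (δ ^ 2 * (∑ i, p i * ‖A - a i‖ ^ 2)) * (‖d‖ ^ 2 + ‖x‖ ^ 2)) := by
  set β := Real.exp (‖A‖ * T) with hβ
  set V := ∑ i, p i * ‖A - a i‖ ^ 2 with hV
  set m := Real.exp (μ * δ) with hm
  have hm2 : Real.exp (2 * μ * δ) = m ^ 2 := by
    rw [hm, ← Real.exp_nat_mul]; congr 1; push_cast; ring
  have hT : 0 ≤ T := hδ.trans hδT
  have hβ1 : 1 ≤ β := Real.one_le_exp (by positivity)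
  have hm1 : 1 ≤ m := Real.one_le_exp (by positivity)
  have hV0 : 0 ≤ V := Finset.sum_nonneg fun i _ => mul_nonneg (hp i) (sq_nonneg _)
  have hbb : Real.exp (‖A‖ * δ) ≤ β := Real.exp_le_exp.2 (by gcongr)
  have hmean : ‖∑ i, p i • (ex (a i) δ - ex A δ)‖ ≤ δ ^ 2 * V * m * β ^ 2 :=
    (ex_mean_le hp hp1 hA hμ0 hμ hδ).trans (by gcongr)
  have hsq : ∑ i, p i * ‖ex (a i) δ - ex A δ‖ ^ 2 ≤ δ ^ 2 * V * m ^ 2 * β ^ 2 := by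
    rw [hV, Finset.mul_sum, Finset.sum_mul, Finset.sum_mul]
    refine Finset.sum_le_sum fun i _ => ?_
    have h1 : ‖ex (a i) δ - ex A δ‖ ≤ δ * ‖A - a i‖ * m * β :=
      (ex_diff_le (A := A) hμ0 (hμ i) hδ).trans (by gcongr)
    calc p i * ‖ex (a i) δ - ex A δ‖ ^ 2 ≤ p i * (δ * ‖A - a i‖ * m * β) ^ 2 :=
          mul_le_mul_of_nonneg_left (pow_le_pow_left₀ (norm_nonneg _) h1 2) (hp i)
      _ = _ := by ring
  have t1 : ∑ i, p i * ‖ex (a i) δ d‖ ^ 2 ≤ m ^ 2 * ‖d‖ ^ 2 := by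
    calc ∑ i, p i * ‖ex (a i) δ d‖ ^ 2 ≤ ∑ i, p i * (m * ‖d‖) ^ 2 := by
          refine Finset.sum_le_sum fun i _ => mul_le_mul_of_nonneg_left ?_ (hp i)
          have := (ex (a i) δ).le_of_opNorm_le (ex_norm_le (hμ i) hδ) d
          gcongr
      _ = _ := by rw [← Finset.sum_mul, hp1]; ring
  have t3 : ∑ i, p i * ‖(ex (a i) δ - ex A δ) x‖ ^ 2 ≤ δ ^ 2 * V * m ^ 2 * β ^ 2 * ‖x‖ ^ 2 := by
    calc _ ≤ ∑ i, p i * ‖ex (a i) δ - ex A δ‖ ^ 2 * ‖x‖ ^ 2 := by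
          refine Finset.sum_le_sum fun i _ => ?_
          rw [mul_assoc, ← mul_pow]
          refine mul_le_mul_of_nonneg_left ?_ (hp i)
          have := (ex (a i) δ - ex A δ).le_opNorm x
          gcongr
      _ ≤ _ := by rw [← Finset.sum_mul]; gcongr
  have t2 : ∑ i, p i * inner ℝ (ex (a i) δ d) ((ex (a i) δ - ex A δ) x) ≤
      2 * (δ ^ 2 * V) * m ^ 2 * β ^ 3 * ‖d‖ * ‖x‖ := by
    have e : ∑ i, p i * inner ℝ (ex (a i) δ d) ((ex (a i) δ - ex A δ) x) =
        inner ℝ (ex A δ d) ((∑ i, p i • (ex (a i) δ - ex A δ)) x) +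
        ∑ i, p i * inner ℝ ((ex (a i) δ - ex A δ) d) ((ex (a i) δ - ex A δ) x) := by
      rw [_root_.sum_apply, inner_sum, ← Finset.sum_add_distrib]
      refine Finset.sum_congr rfl fun i _ => ?_
      rw [_root_.smul_apply, real_inner_smul_right, ← mul_add, ← inner_add_left]
      congr 2
      simp
    rw [e]
    have i1 : inner ℝ (ex A δ d) ((∑ i, p i • (ex (a i) δ - ex A δ)) x) ≤
        (δ ^ 2 * V) * m ^ 2 * β ^ 3 * ‖d‖ * ‖x‖ := by
      calc _ ≤ ‖ex A δ d‖ * ‖(∑ i, p i • (ex (a i) δ - ex A δ)) x‖ := real_inner_le_norm _ _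
        _ ≤ (β * ‖d‖) * ((δ ^ 2 * V * m * β ^ 2) * ‖x‖) := by
          have h1 := (ex A δ).le_of_opNorm_le ((ex_norm_le' A hδ).trans hbb) d
          have h2 := (∑ i, p i • (ex (a i) δ - ex A δ)).le_of_opNorm_le hmean x
          gcongr
        _ = (δ ^ 2 * V) * m * β ^ 3 * ‖d‖ * ‖x‖ := by ring
        _ ≤ _ := by
          have : m ≤ m ^ 2 := by nlinarith
          gcongr
    have i2 : ∑ i, p i * inner ℝ ((ex (a i) δ - ex A δ) d) ((ex (a i) δ - ex A δ) x) ≤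
        (δ ^ 2 * V) * m ^ 2 * β ^ 3 * ‖d‖ * ‖x‖ := by
      calc _ ≤ ∑ i, p i * ‖ex (a i) δ - ex A δ‖ ^ 2 * (‖d‖ * ‖x‖) := by
            refine Finset.sum_le_sum fun i _ => ?_
            rw [mul_assoc]
            refine mul_le_mul_of_nonneg_left ?_ (hp i)
            refine (real_inner_le_norm _ _).trans ?_
            calc _ ≤ (‖ex (a i) δ - ex A δ‖ * ‖d‖) * (‖ex (a i) δ - ex A δ‖ * ‖x‖) := by
                  gcongr
                  · exact (ex (a i) δ - ex A δ).le_opNorm d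
                  · exact (ex (a i) δ - ex A δ).le_opNorm x
              _ = _ := by ring
        _ ≤ δ ^ 2 * V * m ^ 2 * β ^ 2 * (‖d‖ * ‖x‖) := by rw [← Finset.sum_mul]; gcongr
        _ ≤ δ ^ 2 * V * m ^ 2 * β ^ 3 * (‖d‖ * ‖x‖) := by
          have : β ^ 2 ≤ β ^ 3 := pow_le_pow_right₀ hβ1 (by norm_num)
          gcongr
        _ = _ := by ring
    linarith
  have key : ∑ i, p i * ‖ex (a i) δ d + (ex (a i) δ - ex A δ) x‖ ^ 2 =
      ∑ i, p i * ‖ex (a i) δ d‖ ^ 2 +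
      2 * ∑ i, p i * inner ℝ (ex (a i) δ d) ((ex (a i) δ - ex A δ) x) +
      ∑ i, p i * ‖(ex (a i) δ - ex A δ) x‖ ^ 2 := by
    rw [Finset.mul_sum, ← Finset.sum_add_distrib, ← Finset.sum_add_distrib]
    refine Finset.sum_congr rfl fun i _ => ?_
    rw [norm_add_sq_real]; ring
  rw [key, hm2]
  have hc : 0 ≤ δ ^ 2 * V * m ^ 2 := by positivity
  have b23 : β ^ 2 ≤ β ^ 3 := pow_le_pow_right₀ hβ1 (by norm_num)
  have k1 : δ ^ 2 * V * m ^ 2 * β ^ 2 * ‖x‖ ^ 2 ≤ δ ^ 2 * V * m ^ 2 * β ^ 3 * ‖x‖ ^ 2 := by gcongr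
  have hc3 : 0 ≤ δ ^ 2 * V * m ^ 2 * β ^ 3 := by positivity
  have k2 : 2 * (‖d‖ * ‖x‖) ≤ ‖d‖ ^ 2 + ‖x‖ ^ 2 := by nlinarith [sq_nonneg (‖d‖ - ‖x‖)]
  have k3 := mul_le_mul_of_nonneg_left k2 hc3
  have k4 : 0 ≤ δ ^ 2 * V * m ^ 2 * β ^ 3 * ‖d‖ ^ 2 := by positivity
  nlinarith

end ops
end FB

open MeasureTheory Matrix Set
namespace FB
set_option linter.unusedSectionVars false

/-- expectation over i.i.d. draws -/
noncomputable def Ex {I : Type*} [Fintype I] {K : ℕ} (p : I → ℝ) (X : (Fin K → I) → ℝ) : ℝ :=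
  ∑ ω : Fin K → I, (∏ k, p (ω k)) * X ω

section exl
variable {I : Type*} [Fintype I] {p : I → ℝ}

lemma Ex_succ {K : ℕ} (X : (Fin (K + 1) → I) → ℝ) :
    Ex p X = Ex p (fun ω : Fin K → I => ∑ i, p i * X (Fin.snoc (α := fun _ => I) ω i)) := by
  unfold Ex
  rw [← (Fin.snocEquiv (fun _ : Fin (K + 1) => I)).sum_comp, Fintype.sum_prod_type_right]
  refine Finset.sum_congr rfl fun ω _ => ?_
  rw [Finset.mul_sum]
  refine Finset.sum_congr rfl fun i _ => ?_
  have h1 : (Fin.snocEquiv (fun _ : Fin (K + 1) => I)) (i, ω) = Fin.snoc (α := fun _ => I) ω i := rfl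
  rw [h1, Fin.prod_univ_castSucc]
  simp only [Fin.snoc_castSucc, Fin.snoc_last]
  ring

lemma Ex_mono (hp : ∀ i, 0 ≤ p i) {K : ℕ} {X Y : (Fin K → I) → ℝ} (h : ∀ ω, X ω ≤ Y ω) :
    Ex p X ≤ Ex p Y :=
  Finset.sum_le_sum fun ω _ => mul_le_mul_of_nonneg_left (h ω) (Finset.prod_nonneg fun _ _ => hp _)

lemma Ex_add {K : ℕ} (X Y : (Fin K → I) → ℝ) :
    Ex p (fun ω => X ω + Y ω) = Ex p X + Ex p Y := by
  simp only [Ex, mul_add, Finset.sum_add_distrib]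

lemma Ex_mul {K : ℕ} (c : ℝ) (X : (Fin K → I) → ℝ) :
    Ex p (fun ω => c * X ω) = c * Ex p X := by
  simp only [Ex, Finset.mul_sum]
  exact Finset.sum_congr rfl fun ω _ => by ring

lemma Ex_const (hp1 : ∑ i, p i = 1) (K : ℕ) (c : ℝ) :
    Ex p (fun _ : Fin K → I => c) = c := by
  induction K with
  | zero => simp [Ex]
  | succ K ih => rw [Ex_succ]; simp only [← Finset.sum_mul, hp1, one_mul]; exact ih

lemma Ex_sum {ι : Type*} (s : Finset ι) {K : ℕ} (X : ι → (Fin K → I) → ℝ) :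
    Ex p (fun ω => ∑ i ∈ s, X i ω) = ∑ i ∈ s, Ex p (X i) := by
  simp only [Ex, Finset.mul_sum]
  exact Finset.sum_comm

lemma Ex_nonneg (hp : ∀ i, 0 ≤ p i) {K : ℕ} {X : (Fin K → I) → ℝ} (h : ∀ ω, 0 ≤ X ω) :
    0 ≤ Ex p X :=
  Finset.sum_nonneg fun ω _ => mul_nonneg (Finset.prod_nonneg fun _ _ => hp _) (h ω)

end exl

section ops
variable {E : Type*} [NormedAddCommGroup E] [InnerProductSpace ℝ E] [CompleteSpace E]

/-- ordered product of exponentials -/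
noncomputable def Vp (a : ℕ → E →L[ℝ] E) (δ : ℕ → ℝ) : ℕ → E →L[ℝ] E
  | 0 => 1
  | k + 1 => ex (a k) (δ k) * Vp a δ k

lemma Vp_congr {a b : ℕ → E →L[ℝ] E} {δ δ' : ℕ → ℝ} {K : ℕ} (h : ∀ k < K, a k = b k)
    (h' : ∀ k < K, δ k = δ' k) : Vp a δ K = Vp b δ' K := by
  induction K with
  | zero => rfl
  | succ K ih =>
    simp only [Vp]
    rw [h K (by omega), h' K (by omega), ih (fun k hk => h k (by omega)) (fun k hk => h' k (by omega))]

/-- the matrices along a draw -/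
noncomputable def sq {I : Type*} (a : I → E →L[ℝ] E) {K : ℕ} (ω : Fin K → I) (k : ℕ) : E →L[ℝ] E :=
  if hk : k < K then a (ω ⟨k, hk⟩) else 0

lemma Vp_snoc {I : Type*} (a : I → E →L[ℝ] E) {K : ℕ} (ω : Fin K → I) (i : I) (δ : ℕ → ℝ) :
    Vp (sq a (Fin.snoc (α := fun _ => I) ω i : Fin (K + 1) → I)) δ (K + 1) =
      ex (a i) (δ K) * Vp (sq a ω) δ K := by
  simp only [Vp]
  congr 1
  · congr 1
    simp only [sq, Nat.lt_succ_self, dif_pos]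
    congr 1
    exact Fin.snoc_last (α := fun _ => I) i ω
  · refine Vp_congr (fun k hk => ?_) (fun _ _ => rfl)
    simp only [sq, hk, Nat.lt_succ_of_lt hk, dif_pos]
    congr 1
    exact Fin.snoc_castSucc (α := fun _ => I) i ω ⟨k, hk⟩

lemma stoch {I : Type*} [Fintype I] {p : I → ℝ} (hp : ∀ i, 0 ≤ p i) (hp1 : ∑ i, p i = 1)
    {a : I → E →L[ℝ] E} {A : E →L[ℝ] E} (hA : ∑ i, p i • a i = A) {μ : ℝ} (hμ0 : 0 ≤ μ)
    (hμ : ∀ i x, inner ℝ (a i x) x ≤ μ * ‖x‖ ^ 2) {h T : ℝ}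
    (hV : h * (∑ i, p i * ‖A - a i‖ ^ 2) ≤ 1)
    {δ : ℕ → ℝ} (hδ : ∀ k, 0 ≤ δ k) (hδh : ∀ k, δ k ≤ h) (v : E) (K : ℕ)
    (hsum : ∑ k ∈ Finset.range K, δ k ≤ T) :
    Ex p (fun ω : Fin K → I => ‖Vp (sq a ω) δ K v - ex A (∑ k ∈ Finset.range K, δ k) v‖ ^ 2) ≤
      Real.exp (2 * μ * ∑ k ∈ Finset.range K, δ k) *
       (Real.exp (3 * Real.exp (‖A‖ * T) ^ 3 * ∑ k ∈ Finset.range K, δ k) - 1) *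
        (h * (∑ i, p i * ‖A - a i‖ ^ 2) * (Real.exp (‖A‖ * T) ^ 2 * ‖v‖ ^ 2)) := by
  induction K with
  | zero => simp [Ex, Vp, ex_zero]
  | succ K ih =>
    set β := Real.exp (‖A‖ * T) with hβ
    set V := ∑ i, p i * ‖A - a i‖ ^ 2 with hVdef
    have hV0 : 0 ≤ V := Finset.sum_nonneg fun i _ => mul_nonneg (hp i) (sq_nonneg _)
    rw [Finset.sum_range_succ] at hsum ⊢
    set σs := ∑ k ∈ Finset.range K, δ k with hsg
    have hsg0 : 0 ≤ σs := Finset.sum_nonneg fun k _ => hδ k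
    have ih := ih (by linarith [hδ K])
    set c := 3 * β ^ 3 with hc
    have hc0 : 0 ≤ c := by positivity
    have hh : 0 ≤ h := (hδ 0).trans (hδh 0)
    have hβ0 : 0 ≤ β := (Real.exp_pos _).le
    have hx : ‖ex A σs v‖ ^ 2 ≤ β ^ 2 * ‖v‖ ^ 2 := by
      have := (ex A σs).le_of_opNorm_le (ex_norm_le' A hsg0) v
      rw [← mul_pow]
      have h2 : Real.exp (‖A‖ * σs) ≤ β := Real.exp_le_exp.2
        (mul_le_mul_of_nonneg_left (by linarith [hδ K]) (norm_nonneg _))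
      have : ‖ex A σs v‖ ≤ β * ‖v‖ := this.trans (by gcongr)
      gcongr
    rw [Ex_succ]
    set e := h * V * (β ^ 2 * ‖v‖ ^ 2) with he
    have he0 : 0 ≤ e := by positivity
    have hdV : δ K ^ 2 * V ≤ δ K * (h * V) := by
      have := mul_le_mul_of_nonneg_right (mul_le_mul_of_nonneg_left (hδh K) (hδ K)) hV0
      linarith
    have step : Ex p (fun ω : Fin K → I => ∑ i, p i *
        ‖Vp (sq a (Fin.snoc (α := fun _ => I) ω i : Fin (K + 1) → I)) δ (K + 1) v -
          ex A (σs + δ K) v‖ ^ 2) ≤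
        Ex p (fun ω : Fin K → I => Real.exp (2 * μ * δ K) * ((1 + c * δ K) *
          ‖Vp (sq a ω) δ K v - ex A σs v‖ ^ 2) + Real.exp (2 * μ * δ K) * (c * δ K * e)) := by
      refine Ex_mono hp fun ω => ?_
      set d := Vp (sq a ω) δ K v - ex A σs v with hd
      have e1 : ∀ i, Vp (sq a (Fin.snoc (α := fun _ => I) ω i : Fin (K + 1) → I)) δ (K + 1) v -
          ex A (σs + δ K) v = ex (a i) (δ K) d + (ex (a i) (δ K) - ex A (δ K)) (ex A σs v) := by
        intro i
        rw [Vp_snoc, add_comm σs, ex_add, hd]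
        simp
      simp only [e1]
      refine (one_step hp hp1 hA hμ0 hμ (hδ K) (show δ K ≤ T by linarith) d (ex A σs v)).trans ?_
      rw [← mul_add, ← hβ, ← hVdef, ← hc]
      refine mul_le_mul_of_nonneg_left ?_ (Real.exp_pos _).le
      have g1 : c * (δ K ^ 2 * V) * ‖d‖ ^ 2 ≤ c * δ K * ‖d‖ ^ 2 := by
        have : δ K ^ 2 * V ≤ δ K := hdV.trans (by
          have := mul_le_mul_of_nonneg_left hV (hδ K); linarith)
        gcongr
      have g2 : c * (δ K ^ 2 * V) * ‖ex A σs v‖ ^ 2 ≤ c * δ K * e := by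
        have hK := hδ K
        calc _ ≤ c * (δ K * (h * V)) * (β ^ 2 * ‖v‖ ^ 2) := by gcongr
          _ = _ := by rw [he]; ring
      linarith
    refine step.trans ?_
    rw [Ex_add, Ex_const hp1, Ex_mul, Ex_mul]
    have e2 : Real.exp (2 * μ * (σs + δ K)) = Real.exp (2 * μ * δ K) * Real.exp (2 * μ * σs) := by
      rw [← Real.exp_add]; ring_nf
    have e3 : (1 + c * δ K) * Real.exp (c * σs) ≤ Real.exp (c * (σs + δ K)) := by
      rw [mul_add, Real.exp_add, mul_comm]
      have := Real.add_one_le_exp (c * δ K)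
      gcongr
      linarith
    rw [e2, ← mul_add, show Real.exp (2 * μ * δ K) * Real.exp (2 * μ * σs) *
      (Real.exp (c * (σs + δ K)) - 1) * e = Real.exp (2 * μ * δ K) * (Real.exp (2 * μ * σs) *
      ((Real.exp (c * (σs + δ K)) - 1) * e)) by ring]
    refine mul_le_mul_of_nonneg_left ?_ (Real.exp_pos _).le
    have hK := hδ K
    have e4 : 1 ≤ Real.exp (2 * μ * σs) := Real.one_le_exp (by positivity)
    calc (1 + c * δ K) * Ex p (fun ω : Fin K → I => ‖Vp (sq a ω) δ K v - ex A σs v‖ ^ 2) + c * δ K * e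
        ≤ (1 + c * δ K) * (Real.exp (2 * μ * σs) * (Real.exp (c * σs) - 1) * e) +
          Real.exp (2 * μ * σs) * (c * δ K * e) := by
          refine add_le_add (mul_le_mul_of_nonneg_left ih
            (add_nonneg zero_le_one (mul_nonneg hc0 hK))) ?_
          exact le_mul_of_one_le_left (mul_nonneg (mul_nonneg hc0 hK) he0) e4
      _ = Real.exp (2 * μ * σs) * (((1 + c * δ K) * Real.exp (c * σs) - 1) * e) := by ring
      _ ≤ _ := by gcongr

end ops
end FB

open MeasureTheory Matrix Set
namespace FB
set_option linter.unusedSectionVars false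

/-- length of `[0,x] ∩ [kh,(k+1)h]` -/
noncomputable def cl (h : ℝ) (k : ℕ) (x : ℝ) : ℝ := min x (((k + 1 : ℕ) : ℝ) * h) - min x ((k : ℝ) * h)

lemma cl_cont (h : ℝ) (k : ℕ) : Continuous (cl h k) := by
  unfold cl; fun_prop

lemma cl_sum (h : ℝ) (K : ℕ) {x : ℝ} (hx : 0 ≤ x) (hxK : x ≤ K * h) :
    ∑ k ∈ Finset.range K, cl h k x = x := by
  unfold cl
  rw [Finset.sum_range_sub (fun k : ℕ => min x ((k : ℝ) * h))]
  simp [hx, hxK]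

lemma cl_mono {h : ℝ} (hh : 0 < h) (k : ℕ) {t s : ℝ} (hts : t ≤ s) :
    0 ≤ cl h k s - cl h k t ∧ cl h k s - cl h k t ≤ h := by
  unfold cl
  push_cast
  have e : ((k : ℝ) + 1) * h = k * h + h := by ring
  rw [e]
  generalize (k : ℝ) * h = u
  constructor <;> grind

lemma cl_after {h : ℝ} (hh : 0 < h) {k j : ℕ} (hkj : j < k) {t : ℝ} (ht : t ≤ (j + 1) * h) :
    cl h k t = 0 := by
  have h1 : ((j : ℝ) + 1) ≤ k := by exact_mod_cast hkj
  have h2 : t ≤ k * h := ht.trans (by gcongr)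
  have h3 : t ≤ ((k : ℝ) + 1) * h := h2.trans (by gcongr; linarith)
  simp [cl, h2, h3]

lemma cl_before {h : ℝ} (hh : 0 < h) {k j : ℕ} (hkj : k < j) {t : ℝ} (ht : j * h ≤ t) :
    cl h k t = h := by
  have h1 : ((k : ℝ) + 1) ≤ j := by exact_mod_cast hkj
  have h2 : (k + 1 : ℝ) * h ≤ t := le_trans (by gcongr) ht
  have h3 : (k : ℝ) * h ≤ t := le_trans (by gcongr; linarith) h2
  simp [cl, h2, h3]
  ring

lemma cl_at {h : ℝ} {j : ℕ} {t : ℝ} (ht : j * h ≤ t) (ht' : t ≤ (j + 1) * h) :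
    cl h j t = t - j * h := by
  simp [cl, ht, ht']

lemma cl_step {h : ℝ} (hh : 0 < h) (k : ℕ) {j : ℕ} {t t' : ℝ} (ht : j * h ≤ t) (htt : t ≤ t')
    (ht' : t' ≤ (j + 1) * h) : cl h k t' = cl h k t + if k = j then t' - t else 0 := by
  rcases lt_trichotomy k j with hk | hk | hk
  · rw [cl_before hh hk ht, cl_before hh hk (ht.trans htt)]; simp [hk.ne]
  · subst hk
    rw [cl_at ht (htt.trans ht'), cl_at (ht.trans htt) ht']; simp
  · rw [cl_after hh hk ht', cl_after hh hk (htt.trans ht')]; simp [hk.ne']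

section ops
variable {E : Type*} [NormedAddCommGroup E] [InnerProductSpace ℝ E] [CompleteSpace E]

lemma Vp_left (a : ℕ → E →L[ℝ] E) (δ : ℕ → ℝ) (j : ℕ) (x : ℝ) {K : ℕ} (hK : j < K)
    (h0 : ∀ k, j < k → δ k = 0) :
    Vp a (fun k => δ k + if k = j then x else 0) K = ex (a j) x * Vp a δ K := by
  induction K with
  | zero => omega
  | succ K ih =>
    rcases Nat.lt_or_ge j K with hj | hj
    · simp only [Vp]
      rw [ih hj, h0 K hj, if_neg hj.ne', add_zero, ex_zero, one_mul, one_mul]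
    · have : j = K := by omega
      subst this
      simp only [Vp, if_true]
      rw [add_comm, ex_add, mul_assoc]
      congr 2
      exact Vp_congr (fun _ _ => rfl) fun k hk => by simp [hk.ne]

lemma Vp_one (a : ℕ → E →L[ℝ] E) (δ : ℕ → ℝ) (K : ℕ) (h0 : ∀ k, k < K → δ k = 0) :
    Vp a δ K = 1 := by
  induction K with
  | zero => rfl
  | succ K ih =>
    simp only [Vp]
    rw [ih (fun k hk => h0 k (by omega)), h0 K (by omega), ex_zero, one_mul]

lemma Vp_right (a : ℕ → E →L[ℝ] E) (δ : ℕ → ℝ) (j : ℕ) (x : ℝ) {K : ℕ} (hK : j < K)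
    (h0 : ∀ k, k < j → δ k = 0) :
    Vp a (fun k => δ k + if k = j then x else 0) K = Vp a δ K * ex (a j) x := by
  induction K with
  | zero => omega
  | succ K ih =>
    rcases Nat.lt_or_ge j K with hj | hj
    · simp only [Vp]
      rw [ih hj, if_neg hj.ne', add_zero, mul_assoc]
    · have : j = K := by omega
      subst this
      simp only [Vp, if_true]
      rw [Vp_one a δ _ h0, Vp_one a _ _ (fun k hk => by simp [hk.ne, h0 k hk]), ex_add]
      simp

lemma Vp_norm {a : ℕ → E →L[ℝ] E} {μ : ℝ} 
    (hμ : ∀ i x, inner ℝ (a i x) x ≤ μ * ‖x‖ ^ 2) {δ : ℕ → ℝ} (hδ : ∀ k, 0 ≤ δ k) (K : ℕ) :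
    ‖Vp a δ K‖ ≤ Real.exp (μ * ∑ k ∈ Finset.range K, δ k) := by
  induction K with
  | zero => 
    have h1 : ‖(1 : E →L[ℝ] E)‖ ≤ 1 := ContinuousLinearMap.norm_id_le
    simpa [Vp] using h1
  | succ K ih =>
    simp only [Vp]
    rw [Finset.sum_range_succ, mul_add, Real.exp_add, mul_comm (Real.exp _)]
    refine (norm_mul_le _ _).trans ?_
    gcongr
    exact ex_norm_le (hμ K) (hδ K)

/-- the random evolution operator -/
noncomputable def U (a : ℕ → E →L[ℝ] E) (h : ℝ) (K : ℕ) (s t : ℝ) : E →L[ℝ] E :=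
  Vp a (fun k => cl h k s - cl h k t) K

lemma Vp_cont (a : ℕ → E →L[ℝ] E) (δ : ℕ → ℝ → ℝ) (hδ : ∀ k, Continuous (δ k)) (K : ℕ) :
    Continuous (fun s => Vp a (fun k => δ k s) K) := by
  induction K with
  | zero => exact continuous_const
  | succ K ih =>
    simp only [Vp]
    exact ((ex_cont (a K)).comp (hδ K)).mul ih

lemma U_cont_left (a : ℕ → E →L[ℝ] E) (h : ℝ) (K : ℕ) (t : ℝ) :
    Continuous (fun s => U a h K s t) :=
  Vp_cont a (fun k s => cl h k s - cl h k t) (fun k => (cl_cont h k).sub continuous_const) K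

lemma U_cont_right (a : ℕ → E →L[ℝ] E) (h : ℝ) (K : ℕ) (s : ℝ) :
    Continuous (fun t => U a h K s t) :=
  Vp_cont a (fun k t => cl h k s - cl h k t) (fun k => continuous_const.sub (cl_cont h k)) K

lemma U_self (a : ℕ → E →L[ℝ] E) (h : ℝ) (K : ℕ) (t : ℝ) : U a h K t t = 1 :=
  Vp_one _ _ _ fun _ _ => sub_self _

lemma U_norm {a : ℕ → E →L[ℝ] E} {μ : ℝ} 
    (hμ : ∀ i x, inner ℝ (a i x) x ≤ μ * ‖x‖ ^ 2) {h : ℝ} (hh : 0 < h) {K : ℕ} {t s : ℝ}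
    (ht : 0 ≤ t) (hts : t ≤ s) (hs : s ≤ K * h) :
    ‖U a h K s t‖ ≤ Real.exp (μ * (s - t)) := by
  refine (Vp_norm hμ (fun k => (cl_mono hh k hts).1) K).trans (le_of_eq ?_)
  rw [Finset.sum_sub_distrib, cl_sum h K (ht.trans hts) hs, cl_sum h K ht (hts.trans hs)]

lemma U_deriv_left (a : ℕ → E →L[ℝ] E) {h : ℝ} (hh : 0 < h) {K : ℕ} {t s : ℝ}
    (hts : t ≤ s) {j : ℕ} (hj : j < K) (hs : j * h ≤ s) (hs' : s < (j + 1) * h) :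
    HasDerivWithinAt (fun s => U a h K s t) (a j * U a h K s t) (Ici s) s := by
  have h1 : HasDerivWithinAt (fun r => ex (a j) (r - s) * U a h K s t) (a j * U a h K s t)
      (Ici s) s := by
    have h2 := (ex_deriv (a j) (s - s)).scomp (h := fun r => r - s) s ((hasDerivAt_id s).sub_const s)
    have h3 := (h2.mul_const (U a h K s t)).hasDerivWithinAt (s := Ici s)
    simpa [ex_zero, Function.comp_def] using h3
  refine h1.congr_of_eventuallyEq ?_ (by simp [ex_zero])
  filter_upwards [Icc_mem_nhdsGE hs'] with r hr
  have h4 := Vp_left a (fun k => cl h k s - cl h k t) j (r - s) hj (fun k hk => by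
    rw [cl_after hh hk hs'.le, cl_after hh hk (hts.trans hs'.le), sub_self])
  unfold U
  rw [← h4]
  refine Vp_congr (fun _ _ => rfl) fun k _ => ?_
  rw [cl_step hh k hs hr.1 hr.2]; ring

lemma U_deriv_right (a : ℕ → E →L[ℝ] E) {h : ℝ} (hh : 0 < h) {K : ℕ} {t s : ℝ}
    (hts : t < s) {j : ℕ} (hj : j < K) (ht : j * h ≤ t) (ht' : t < (j + 1) * h) :
    HasDerivWithinAt (fun t => U a h K s t) (-(U a h K s t * a j)) (Ici t) t := by
  have h1 : HasDerivWithinAt (fun r => U a h K s t * ex (a j) (-(r - t))) (-(U a h K s t * a j))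
      (Ici t) t := by
    have h2 := (ex_deriv (a j) (-(t - t))).scomp (h := fun r => -(r - t)) t ((hasDerivAt_id t).sub_const t).neg
    have h3 := (h2.const_mul (U a h K s t)).hasDerivWithinAt (s := Ici t)
    simpa [ex_zero, Function.comp_def] using h3
  refine h1.congr_of_eventuallyEq ?_ (by simp [ex_zero])
  filter_upwards [Icc_mem_nhdsGE ht'] with r hr
  have h4 := Vp_right a (fun k => cl h k s - cl h k t) j (-(r - t)) hj (fun k hk => by
    rw [cl_before hh hk ht, cl_before hh hk (ht.trans hts.le), sub_self])
  unfold U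
  rw [← h4]
  refine Vp_congr (fun _ _ => rfl) fun k _ => ?_
  rw [cl_step hh k ht hr.1 hr.2]; split_ifs <;> ring

lemma floor_facts {h : ℝ} (hh : 0 < h) {K : ℕ} {t : ℝ} (ht : 0 ≤ t) (htT : t < K * h) :
    ⌊t / h⌋₊ < K ∧ (⌊t / h⌋₊ : ℝ) * h ≤ t ∧ t < (⌊t / h⌋₊ + 1) * h := by
  have h0 : 0 ≤ t / h := by positivity
  refine ⟨?_, ?_, ?_⟩
  · rw [Nat.floor_lt h0, div_lt_iff₀ hh]; exact htT
  · rw [← le_div_iff₀ hh]; exact Nat.floor_le h0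
  · rw [← div_lt_iff₀ hh]; exact Nat.lt_floor_add_one _

end ops
end FB

open MeasureTheory Matrix Set
namespace FB
set_option linter.unusedSectionVars false

lemma ftc {X : Type*} [NormedAddCommGroup X] [NormedSpace ℝ X] [CompleteSpace X]
    {f f' : ℝ → X} {a b : ℝ} (hab : a ≤ b) (hf : ContinuousOn f (Icc a b))
    (hd : ∀ t ∈ Ioo a b, HasDerivWithinAt f (f' t) (Ici t) t) (hf' : ContinuousOn f' (Icc a b)) :
    ∫ s in a..b, f' s = f b - f a := by
  refine intervalIntegral.integral_eq_sub_of_hasDeriv_right (by rwa [uIcc_of_le hab]) ?_ ?_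
  · intro t ht
    rw [min_eq_left hab, max_eq_right hab] at ht
    exact (hd t ht).mono Ioi_subset_Ici_self
  · exact ContinuousOn.intervalIntegrable (by rwa [uIcc_of_le hab])

section ops
variable {E : Type*} [NormedAddCommGroup E] [InnerProductSpace ℝ E] [CompleteSpace E]

/-- forward Duhamel with an abstract evolution family -/
lemma duh_fwd {Z : ℝ → E →L[ℝ] E} {b : ℝ → E →L[ℝ] E} {x f : ℝ → E} {t : ℝ} (ht : 0 ≤ t)
    (hZc : Continuous Z) (hZt : Z t = 1)
    (hZ : ∀ s ∈ Ioo 0 t, HasDerivWithinAt Z (-(Z s * b s)) (Ici s) s)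
    (xc : ContinuousOn x (Icc 0 t)) (fc : ContinuousOn f (Icc 0 t))
    (xd : ∀ s ∈ Ioo 0 t, HasDerivWithinAt x (b s (x s) - f s) (Ici s) s) :
    x t = Z 0 (x 0) - ∫ s in (0 : ℝ)..t, Z s (f s) := by
  have h1 := ftc (f := fun s => Z s (x s)) (f' := fun s => -(Z s (f s))) ht
    (hZc.continuousOn.clm_apply xc) ?_ (hZc.continuousOn.clm_apply fc).neg
  · rw [intervalIntegral.integral_neg, hZt] at h1
    simp only [one_apply_eq_self] at h1
    rw [sub_eq_add_neg, h1]; abel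
  · intro s hs
    have := (hZ s hs).clm_apply (xd s hs)
    have e : -(Z s (f s)) = (-(Z s * b s)) (x s) + Z s (b s (x s) - f s) := by
      simp; abel
    rw [e]
    exact this

/-- backward Duhamel, weak form -/
lemma duh_bwd {Z : ℝ → E →L[ℝ] E} {b : ℝ → E →L[ℝ] E} {l q : ℝ → E} {t T : ℝ} (ht : t ≤ T)
    (hZc : Continuous Z) (hZt : Z t = 1)
    (hZ : ∀ s ∈ Ioo t T, HasDerivWithinAt Z (b s * Z s) (Ici s) s)
    (lc : ContinuousOn l (Icc t T)) (qc : ContinuousOn q (Icc t T))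
    (ld : ∀ s ∈ Ioo t T, HasDerivWithinAt l
      (-(ContinuousLinearMap.adjoint (b s) (l s)) - q s) (Ici s) s) (v : E) :
    inner ℝ v (l t) = inner ℝ (Z T v) (l T) + ∫ s in t..T, inner ℝ (Z s v) (q s) := by
  have hZv : Continuous fun s => Z s v := hZc.clm_apply continuous_const
  have h1 := ftc (f := fun s => inner ℝ (Z s v) (l s)) (f' := fun s => -(inner ℝ (Z s v) (q s))) ht
    (hZv.continuousOn.inner lc) ?_ (hZv.continuousOn.inner qc).neg
  · rw [intervalIntegral.integral_neg, hZt] at h1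
    simp only [one_apply_eq_self] at h1
    linarith
  · intro s hs
    have h2 := (hZ s hs).clm_apply (hasDerivWithinAt_const s (Ici s) v)
    have := h2.inner ℝ (ld s hs)
    refine this.congr_deriv ?_
    rw [inner_sub_right, inner_neg_right, ContinuousLinearMap.adjoint_inner_right]
    have e : (b s * Z s) v + Z s 0 = b s (Z s v) := by simp
    rw [e]
    ring

structure PathSys (a : ℕ → E →L[ℝ] E) (A S Q F : E →L[ℝ] E) (h : ℝ) (K : ℕ) (T : ℝ)
    (G : ℝ → E →L[ℝ] E) (g μ : ℝ) (x lam y phi : ℝ → E) : Prop where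
  hh : 0 < h
  hT : T = K * h
  hT0 : 0 < T
  hμ0 : 0 ≤ μ
  hμ : ∀ i x, inner ℝ (a i x) x ≤ μ * ‖x‖ ^ 2
  Ss : ∀ x y, inner ℝ (S x) y = inner ℝ x (S y)
  Qs : ∀ x y, inner ℝ (Q x) y = inner ℝ x (Q y)
  Fs : ∀ x y, inner ℝ (F x) y = inner ℝ x (F y)
  S0 : ∀ x, 0 ≤ inner ℝ (S x) x
  Q0 : ∀ x, 0 ≤ inner ℝ (Q x) x
  F0 : ∀ x, 0 ≤ inner ℝ (F x) x
  xc : ContinuousOn x (Icc 0 T)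
  lc : ContinuousOn lam (Icc 0 T)
  yc : ContinuousOn y (Icc 0 T)
  pc : ContinuousOn phi (Icc 0 T)
  Gc : ContinuousOn G (Icc 0 T)
  Gb : ∀ t ∈ Icc 0 T, ‖G t‖ ≤ g
  xd : ∀ t ∈ Ico 0 T, HasDerivWithinAt x (a ⌊t / h⌋₊ (x t) - S (lam t)) (Ici t) t
  ld : ∀ t ∈ Ico 0 T, HasDerivWithinAt lam
    (-(ContinuousLinearMap.adjoint (a ⌊t / h⌋₊) (lam t)) - Q (x t)) (Ici t) t
  yd : ∀ t ∈ Ico 0 T, HasDerivWithinAt y (A (y t) - S (lam t)) (Ici t) t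
  pd : ∀ t ∈ Ico 0 T, HasDerivWithinAt phi
    (-(ContinuousLinearMap.adjoint A (phi t)) - (Q (y t) - G t (phi t - lam t))) (Ici t) t
  lT : lam T = F (x T)
  pT : phi T = F (y T)
  xy : y 0 = x 0

lemma psd_sq {S : E →L[ℝ] E} (Ss : ∀ x y, inner ℝ (S x) y = inner ℝ x (S y))
    (S0 : ∀ x, 0 ≤ inner ℝ (S x) x) (v : E) : ‖S v‖ ^ 2 ≤ ‖S‖ * inner ℝ (S v) v := by
  rcases eq_or_lt_of_le (norm_nonneg S) with h0 | h0
  · have : S = 0 := norm_eq_zero.1 h0.symm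
    simp [this]
  · have h1 := S0 (‖S‖⁻¹ • S v - v)
    have h2 : inner ℝ (S (S v)) (S v) ≤ ‖S‖ * ‖S v‖ ^ 2 := inner_le_op S _
    have h3 : inner ℝ (S (‖S‖⁻¹ • S v - v)) (‖S‖⁻¹ • S v - v) =
        ‖S‖⁻¹ ^ 2 * inner ℝ (S (S v)) (S v) - 2 * (‖S‖⁻¹ * ‖S v‖ ^ 2) + inner ℝ (S v) v := by
      rw [map_sub, map_smul, inner_sub_left, inner_sub_right, inner_sub_right,
        real_inner_smul_left, real_inner_smul_left, real_inner_smul_right, real_inner_smul_right,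
        Ss (S v) v, real_inner_self_eq_norm_sq]
      ring
    rw [h3] at h1
    have h4 : ‖S‖⁻¹ ^ 2 * inner ℝ (S (S v)) (S v) ≤ ‖S‖⁻¹ * ‖S v‖ ^ 2 := by
      calc _ ≤ ‖S‖⁻¹ ^ 2 * (‖S‖ * ‖S v‖ ^ 2) := by gcongr
        _ = _ := by field_simp
    have h5 : ‖S‖⁻¹ * ‖S v‖ ^ 2 ≤ inner ℝ (S v) v := by linarith
    calc ‖S v‖ ^ 2 = ‖S‖ * (‖S‖⁻¹ * ‖S v‖ ^ 2) := by field_simp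
      _ ≤ _ := by gcongr

lemma psd_cs {S : E →L[ℝ] E} (Ss : ∀ x y, inner ℝ (S x) y = inner ℝ x (S y))
    (S0 : ∀ x, 0 ≤ inner ℝ (S x) x) (z v : E) :
    2 * inner ℝ z (S v) ≤ inner ℝ (S z) z + inner ℝ (S v) v := by
  have h1 := S0 (z - v)
  rw [map_sub, inner_sub_left, inner_sub_right, inner_sub_right, Ss z v,
    real_inner_comm (S v) z] at h1
  rw [real_inner_comm z (S v)] at *
  linarith

end ops
end FB

open MeasureTheory Matrix Set
namespace FB
set_option linter.unusedSectionVars false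

section ops
variable {E : Type*} [NormedAddCommGroup E] [InnerProductSpace ℝ E] [CompleteSpace E]
variable {a : ℕ → E →L[ℝ] E} {A S Q F : E →L[ℝ] E} {h : ℝ} {K : ℕ} {T : ℝ}
    {G : ℝ → E →L[ℝ] E} {g μ : ℝ} {x lam y phi : ℝ → E}

lemma ii {X : Type*} [NormedAddCommGroup X] [NormedSpace ℝ X] {f : ℝ → X} {u v T : ℝ}
    (hf : ContinuousOn f (Icc 0 T)) (hu : u ∈ Icc 0 T) (hv : v ∈ Icc 0 T) :
    IntervalIntegrable f volume u v :=
  (hf.mono (uIcc_subset_Icc hu hv)).intervalIntegrable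

/-- the energy of the optimal pair -/
lemma energy (H : PathSys a A S Q F h K T G g μ x lam y phi) :
    inner ℝ (F (x T)) (x T) + ∫ s in (0 : ℝ)..T, (inner ℝ (Q (x s)) (x s) + inner ℝ (S (lam s)) (lam s))
      ≤ (‖F‖ + T * ‖Q‖) * (Real.exp (2 * μ * T) * ‖x 0‖ ^ 2) := by
  have hT0 := H.hT0.le
  have cQx : ContinuousOn (fun s => Q (x s)) (Icc 0 T) := Q.continuous.comp_continuousOn H.xc
  have cSl : ContinuousOn (fun s => S (lam s)) (Icc 0 T) := S.continuous.comp_continuousOn H.lc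
  have cQxx := cQx.inner (𝕜 := ℝ) H.xc
  have cSll := cSl.inner (𝕜 := ℝ) H.lc
  set J := inner ℝ (F (x T)) (x T) +
    ∫ s in (0 : ℝ)..T, (inner ℝ (Q (x s)) (x s) + inner ℝ (S (lam s)) (lam s)) with hJ
  have id1 : inner ℝ (x 0) (lam 0) = J := by
    have h1 := ftc (f := fun s => inner ℝ (x s) (lam s))
      (f' := fun s => -(inner ℝ (Q (x s)) (x s) + inner ℝ (S (lam s)) (lam s))) hT0
      (H.xc.inner H.lc) ?_ (cQxx.add cSll).neg
    · rw [intervalIntegral.integral_neg, H.lT, real_inner_comm] at h1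
      rw [hJ]; linarith
    · intro s hs
      have := (H.xd s ⟨hs.1.le, hs.2⟩).inner ℝ (H.ld s ⟨hs.1.le, hs.2⟩)
      refine this.congr_deriv ?_
      rw [inner_sub_right, inner_neg_right, ContinuousLinearMap.adjoint_inner_right,
        inner_sub_left, real_inner_comm (Q (x s))]
      ring
  have hZ0 : ∀ s ∈ Icc 0 T, ‖U a h K s 0 (x 0)‖ ^ 2 ≤ Real.exp (2 * μ * T) * ‖x 0‖ ^ 2 := by
    intro s hs
    have h1 := (U a h K s 0).le_of_opNorm_le
      (U_norm H.hμ H.hh le_rfl hs.1 (hs.2.trans_eq H.hT)) (x 0)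
    have h2 : Real.exp (μ * (s - 0)) ≤ Real.exp (μ * T) :=
      Real.exp_le_exp.2 (mul_le_mul_of_nonneg_left (by linarith [hs.2]) H.hμ0)
    have h3 : Real.exp (2 * μ * T) = Real.exp (μ * T) ^ 2 := by
      rw [← Real.exp_nat_mul]; congr 1; push_cast; ring
    rw [h3, ← mul_pow]
    have : ‖U a h K s 0 (x 0)‖ ≤ Real.exp (μ * T) * ‖x 0‖ := h1.trans (by gcongr)
    gcongr
  set N := Real.exp (2 * μ * T) * ‖x 0‖ ^ 2 with hN
  have id2 := duh_bwd (Z := fun s => U a h K s 0) (b := fun s => a ⌊s / h⌋₊) (l := lam)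
    (q := fun s => Q (x s)) (t := 0) (T := T) hT0 (U_cont_left a h K 0) (U_self a h K 0)
    (fun s hs => by
      obtain ⟨f1, f2, f3⟩ := floor_facts H.hh hs.1.le (hs.2.trans_eq H.hT)
      exact U_deriv_left a H.hh hs.1.le f1 f2 f3) H.lc cQx
    (fun s hs => H.ld s ⟨hs.1.le, hs.2⟩) (x 0)
  rw [id1, H.lT] at id2
  have cU : ContinuousOn (fun s => U a h K s 0 (x 0)) (Icc 0 T) :=
    ((U_cont_left a h K 0).clm_apply continuous_const).continuousOn
  have b1 : 2 * inner ℝ (U a h K T 0 (x 0)) (F (x T)) ≤ ‖F‖ * N + inner ℝ (F (x T)) (x T) := by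
    refine (psd_cs H.Fs H.F0 _ _).trans (add_le_add ?_ le_rfl)
    refine (inner_le_op F _).trans ?_
    have := hZ0 T ⟨hT0, le_rfl⟩
    gcongr
  have b2 : ∫ s in (0 : ℝ)..T, 2 * inner ℝ (U a h K s 0 (x 0)) (Q (x s)) ≤
      ∫ s in (0 : ℝ)..T, (‖Q‖ * N + (inner ℝ (Q (x s)) (x s) + inner ℝ (S (lam s)) (lam s))) := by
    refine intervalIntegral.integral_mono_on hT0 ?_ ?_ fun s hs => ?_
    · exact ii ((cU.inner cQx).const_mul 2) ⟨le_rfl, hT0⟩ ⟨hT0, le_rfl⟩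
    · exact ii (continuousOn_const.add (cQxx.add cSll)) ⟨le_rfl, hT0⟩ ⟨hT0, le_rfl⟩
    · refine (psd_cs H.Qs H.Q0 _ _).trans (add_le_add ?_ ?_)
      · refine (inner_le_op Q _).trans ?_
        have := hZ0 s hs
        gcongr
      · linarith [H.S0 (lam s)]
  have cJ : ContinuousOn (fun s => inner ℝ (Q (x s)) (x s) + inner ℝ (S (lam s)) (lam s))
    (Icc 0 T) := cQxx.add cSll
  rw [intervalIntegral.integral_const_mul, intervalIntegral.integral_add
    (ii continuousOn_const ⟨le_rfl, hT0⟩ ⟨hT0, le_rfl⟩)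
    (ii cJ ⟨le_rfl, hT0⟩ ⟨hT0, le_rfl⟩), intervalIntegral.integral_const, sub_zero,
    smul_eq_mul] at b2
  have : (‖F‖ + T * ‖Q‖) * N = ‖F‖ * N + T * (‖Q‖ * N) := by ring
  rw [this]
  linarith

/-- constant of the energy bound -/
noncomputable def cG (S Q F : E →L[ℝ] E) (T : ℝ) : ℝ :=
  (‖S‖ + ‖Q‖ + ‖F‖) * (‖F‖ + T * ‖Q‖) + 1

lemma four (H : PathSys a A S Q F h K T G g μ x lam y phi) {G2 : ℝ}
    (hG : cG S Q F T * (Real.exp (2 * μ * T) * ‖x 0‖ ^ 2) ≤ G2) :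
    ‖x 0‖ ^ 2 ≤ G2 ∧ ‖F (x T)‖ ^ 2 ≤ G2 ∧ ∫ s in (0 : ℝ)..T, ‖Q (x s)‖ ^ 2 ≤ G2 ∧
      ∫ s in (0 : ℝ)..T, ‖S (lam s)‖ ^ 2 ≤ G2 := by
  have hT0 := H.hT0.le
  have hJ := energy H
  have cQx : ContinuousOn (fun s => Q (x s)) (Icc 0 T) := Q.continuous.comp_continuousOn H.xc
  have cSl : ContinuousOn (fun s => S (lam s)) (Icc 0 T) := S.continuous.comp_continuousOn H.lc
  have cQxx := cQx.inner (𝕜 := ℝ) H.xc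
  have cSll := cSl.inner (𝕜 := ℝ) H.lc
  have m0 : (0 : ℝ) ∈ Icc 0 T := ⟨le_rfl, hT0⟩
  have mT : T ∈ Icc 0 T := ⟨hT0, le_rfl⟩
  rw [intervalIntegral.integral_add (ii cQxx m0 mT) (ii cSll m0 mT)] at hJ
  have n1 := H.F0 (x T)
  have n2 : 0 ≤ ∫ s in (0 : ℝ)..T, inner ℝ (Q (x s)) (x s) :=
    intervalIntegral.integral_nonneg hT0 fun s _ => H.Q0 _
  have n3 : 0 ≤ ∫ s in (0 : ℝ)..T, inner ℝ (S (lam s)) (lam s) :=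
    intervalIntegral.integral_nonneg hT0 fun s _ => H.S0 _
  have n4 : 1 ≤ Real.exp (2 * μ * T) := Real.one_le_exp (by have := H.hμ0; positivity)
  set N := Real.exp (2 * μ * T) * ‖x 0‖ ^ 2 with hN
  have hN0 : 0 ≤ N := by positivity
  have hNx : ‖x 0‖ ^ 2 ≤ N := le_mul_of_one_le_left (sq_nonneg _) n4
  set c := ‖F‖ + T * ‖Q‖ with hc
  have hc0 : 0 ≤ c := by positivity
  have hcN : 0 ≤ c * N := by positivity
  have s1 : 0 ≤ ‖S‖ * (c * N) := by positivity
  have s2 : 0 ≤ ‖Q‖ * (c * N) := by positivity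
  have s3 : 0 ≤ ‖F‖ * (c * N) := by positivity
  have hG' : ‖S‖ * (c * N) + ‖Q‖ * (c * N) + ‖F‖ * (c * N) + N ≤ G2 := by
    refine le_trans (le_of_eq ?_) hG
    unfold cG; ring
  refine ⟨by linarith, ?_, ?_, ?_⟩
  · have := mul_le_mul_of_nonneg_left (show inner ℝ (F (x T)) (x T) ≤ c * N by linarith)
      (norm_nonneg F)
    linarith [psd_sq H.Fs H.F0 (x T)]
  · have h1 : ∫ s in (0 : ℝ)..T, ‖Q (x s)‖ ^ 2 ≤
        ∫ s in (0 : ℝ)..T, ‖Q‖ * inner ℝ (Q (x s)) (x s) :=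
      intervalIntegral.integral_mono_on hT0 (ii (cQx.norm.pow 2) m0 mT)
        (ii (cQxx.const_mul _) m0 mT) fun s _ => psd_sq H.Qs H.Q0 (x s)
    rw [intervalIntegral.integral_const_mul] at h1
    have := mul_le_mul_of_nonneg_left (show ∫ s in (0 : ℝ)..T, inner ℝ (Q (x s)) (x s) ≤ c * N by
      linarith) (norm_nonneg Q)
    linarith
  · have h1 : ∫ s in (0 : ℝ)..T, ‖S (lam s)‖ ^ 2 ≤
        ∫ s in (0 : ℝ)..T, ‖S‖ * inner ℝ (S (lam s)) (lam s) :=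
      intervalIntegral.integral_mono_on hT0 (ii (cSl.norm.pow 2) m0 mT)
        (ii (cSll.const_mul _) m0 mT) fun s _ => psd_sq H.Ss H.S0 (lam s)
    rw [intervalIntegral.integral_const_mul] at h1
    have := mul_le_mul_of_nonneg_left (show ∫ s in (0 : ℝ)..T, inner ℝ (S (lam s)) (lam s) ≤ c * N by
      linarith) (norm_nonneg S)
    linarith

end ops
end FB

open MeasureTheory Matrix Set
namespace FB
set_option linter.unusedSectionVars false

section ops
variable {E : Type*} [NormedAddCommGroup E] [InnerProductSpace ℝ E] [CompleteSpace E]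
variable {a : ℕ → E →L[ℝ] E} {A S Q F : E →L[ℝ] E} {h : ℝ} {K : ℕ} {T : ℝ}
    {G : ℝ → E →L[ℝ] E} {g μ : ℝ} {x lam y phi : ℝ → E}

/-- difference of the random and the averaged propagators -/
noncomputable def Dd (a : ℕ → E →L[ℝ] E) (A : E →L[ℝ] E) (h : ℝ) (K : ℕ) (s t : ℝ) : E →L[ℝ] E :=
  U a h K s t - ex A (s - t)

lemma Dd_cont_left (a : ℕ → E →L[ℝ] E) (A : E →L[ℝ] E) (h : ℝ) (K : ℕ) (t : ℝ) :
    Continuous (fun s => Dd a A h K s t) :=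
  (U_cont_left a h K t).sub ((ex_cont A).comp (continuous_id.sub continuous_const))

lemma Dd_cont_right (a : ℕ → E →L[ℝ] E) (A : E →L[ℝ] E) (h : ℝ) (K : ℕ) (s : ℝ) :
    Continuous (fun t => Dd a A h K s t) :=
  (U_cont_right a h K s).sub ((ex_cont A).comp (continuous_const.sub continuous_id))

lemma amgm {α : ℝ} (hα : 0 < α) (u w : ℝ) : u * w ≤ α * u ^ 2 + w ^ 2 / α := by
  have h1 : 0 ≤ (α * u - w / 2) ^ 2 / α := by positivity
  have h2 : (α * u - w / 2) ^ 2 / α = α * u ^ 2 - u * w + w ^ 2 / α / 4 := by field_simp; ring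
  have h3 : 0 ≤ w ^ 2 / α := by positivity
  linarith

lemma path_e (H : PathSys a A S Q F h K T G g μ x lam y phi) {G2 : ℝ}
    (hG : cG S Q F T * (Real.exp (2 * μ * T) * ‖x 0‖ ^ 2) ≤ G2) {α : ℝ} (hα : 0 < α)
    {t : ℝ} (ht : t ∈ Icc 0 T) :
    ‖y t - x t‖ ≤ α * ‖Dd a A h K t 0‖ ^ 2 + α * (∫ s in (0 : ℝ)..t, ‖Dd a A h K t s‖ ^ 2)
      + 2 * G2 / α := by
  obtain ⟨g1, -, -, g4⟩ := four H hG
  have cSl : ContinuousOn (fun s => S (lam s)) (Icc 0 T) := S.continuous.comp_continuousOn H.lc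
  have sub : Icc 0 t ⊆ Icc 0 T := Icc_subset_Icc_right ht.2
  have m0 : (0 : ℝ) ∈ Icc 0 T := ⟨le_rfl, ht.1.trans ht.2⟩
  have mT : T ∈ Icc 0 T := ⟨ht.1.trans ht.2, le_rfl⟩
  have i1 := duh_fwd (Z := fun s => U a h K t s) (b := fun s => a ⌊s / h⌋₊) (x := x)
    (f := fun s => S (lam s)) ht.1 (U_cont_right a h K t) (U_self a h K t) (fun s hs => by
      obtain ⟨f1, f2, f3⟩ := floor_facts H.hh hs.1.le ((hs.2.trans_le ht.2).trans_eq H.hT)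
      exact U_deriv_right a H.hh hs.2 f1 f2 f3) (H.xc.mono sub) (cSl.mono sub)
    (fun s hs => H.xd s ⟨hs.1.le, hs.2.trans_le ht.2⟩)
  have i2 := duh_fwd (Z := fun s => ex A (t - s)) (b := fun _ => A) (x := y)
    (f := fun s => S (lam s)) ht.1 ((ex_cont A).comp (continuous_const.sub continuous_id))
    (by simp [ex_zero]) (fun s hs => by
      have := (ex_deriv A (t - s)).scomp (h := fun r => t - r) s ((hasDerivAt_id s).const_sub t)
      have := this.hasDerivWithinAt (s := Ici s)
      simpa [Function.comp_def] using this) (H.yc.mono sub) (cSl.mono sub)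
    (fun s hs => H.yd s ⟨hs.1.le, hs.2.trans_le ht.2⟩)
  have cU : ContinuousOn (fun s => U a h K t s (S (lam s))) (Icc 0 T) :=
    (U_cont_right a h K t).continuousOn.clm_apply cSl
  have cE : ContinuousOn (fun s => ex A (t - s) (S (lam s))) (Icc 0 T) :=
    ((ex_cont A).comp (continuous_const.sub continuous_id)).continuousOn.clm_apply cSl
  have cD : ContinuousOn (fun s => Dd a A h K t s) (Icc 0 T) := (Dd_cont_right a A h K t).continuousOn
  have i3 : y t - x t = -(Dd a A h K t 0 (x 0)) + ∫ s in (0 : ℝ)..t, Dd a A h K t s (S (lam s)) := by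
    have : ∫ s in (0 : ℝ)..t, Dd a A h K t s (S (lam s)) =
        (∫ s in (0 : ℝ)..t, U a h K t s (S (lam s))) - ∫ s in (0 : ℝ)..t, ex A (t - s) (S (lam s)) := by
      rw [← intervalIntegral.integral_sub (ii cU m0 ht) (ii cE m0 ht)]
      rfl
    rw [this, i1, i2, H.xy]
    simp only [Dd, _root_.sub_apply]
    abel
  rw [i3]
  refine (norm_add_le _ _).trans ?_
  rw [norm_neg]
  have b1 : ‖Dd a A h K t 0 (x 0)‖ ≤ α * ‖Dd a A h K t 0‖ ^ 2 + G2 / α :=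
    ((Dd a A h K t 0).le_opNorm _).trans ((amgm hα _ _).trans (by gcongr))
  have b2 : ‖∫ s in (0 : ℝ)..t, Dd a A h K t s (S (lam s))‖ ≤
      ∫ s in (0 : ℝ)..t, (α * ‖Dd a A h K t s‖ ^ 2 + α⁻¹ * ‖S (lam s)‖ ^ 2) := by
    refine (intervalIntegral.norm_integral_le_integral_norm ht.1).trans ?_
    refine intervalIntegral.integral_mono_on ht.1 (ii (cD.clm_apply cSl).norm m0 ht)
      (ii ((continuousOn_const.mul (cD.norm.pow 2)).add
        (continuousOn_const.mul (cSl.norm.pow 2))) m0 ht) fun s hs => ?_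
    refine ((Dd a A h K t s).le_opNorm _).trans ((amgm hα _ _).trans (le_of_eq ?_))
    ring
  have c1 : ContinuousOn (fun s => α * ‖Dd a A h K t s‖ ^ 2) (Icc 0 T) :=
    continuousOn_const.mul (cD.norm.pow 2)
  have c2 : ContinuousOn (fun s => α⁻¹ * ‖S (lam s)‖ ^ 2) (Icc 0 T) :=
    continuousOn_const.mul (cSl.norm.pow 2)
  rw [intervalIntegral.integral_add (ii c1 m0 ht) (ii c2 m0 ht), intervalIntegral.integral_const_mul,
    intervalIntegral.integral_const_mul] at b2
  have b3 : ∫ s in (0 : ℝ)..t, ‖S (lam s)‖ ^ 2 ≤ G2 :=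
    (intervalIntegral.integral_mono_interval le_rfl ht.1 ht.2
      (Filter.Eventually.of_forall fun s => pow_nonneg (norm_nonneg _) 2) (ii (cSl.norm.pow 2) m0 mT)).trans g4
  have b4 := mul_le_mul_of_nonneg_left b3 (inv_nonneg.2 hα.le)
  have : 2 * G2 / α = G2 / α + α⁻¹ * G2 := by ring
  rw [this]
  linarith

lemma path_r (H : PathSys a A S Q F h K T G g μ x lam y phi) {G2 : ℝ}
    (hG : cG S Q F T * (Real.exp (2 * μ * T) * ‖x 0‖ ^ 2) ≤ G2) {α : ℝ} (hα : 0 < α)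
    {t : ℝ} (ht : t ∈ Icc 0 T) :
    ‖phi t - lam t‖ ≤ Real.exp (‖A‖ * T) * (‖F‖ * ‖y T - x T‖)
      + Real.exp (‖A‖ * T) * (‖Q‖ * (∫ s in t..T, ‖y s - x s‖) + g * ∫ s in t..T, ‖phi s - lam s‖)
      + (α * ‖Dd a A h K T t‖ ^ 2 + α * (∫ s in t..T, ‖Dd a A h K s t‖ ^ 2) + 2 * G2 / α) := by
  obtain ⟨g1, g2, g3, -⟩ := four H hG
  have m0 : (0 : ℝ) ∈ Icc 0 T := ⟨le_rfl, ht.1.trans ht.2⟩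
  have mT : T ∈ Icc 0 T := ⟨ht.1.trans ht.2, le_rfl⟩
  have sub : Icc t T ⊆ Icc 0 T := Icc_subset_Icc_left ht.1
  have hg : 0 ≤ g := (norm_nonneg _).trans (H.Gb 0 m0)
  have hG0 : 0 ≤ G2 := (sq_nonneg _).trans g1
  have cQx : ContinuousOn (fun s => Q (x s)) (Icc 0 T) := Q.continuous.comp_continuousOn H.xc
  have cr : ContinuousOn (fun s => phi s - lam s) (Icc 0 T) := H.pc.sub H.lc
  have ce : ContinuousOn (fun s => y s - x s) (Icc 0 T) := H.yc.sub H.xc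
  have cq : ContinuousOn (fun s => Q (y s) - G s (phi s - lam s)) (Icc 0 T) :=
    (Q.continuous.comp_continuousOn H.yc).sub (H.Gc.clm_apply cr)
  have cXc : Continuous fun s => ex A (s - t) := (ex_cont A).comp (continuous_id.sub continuous_const)
  have cD : ContinuousOn (fun s => Dd a A h K s t) (Icc 0 T) := (Dd_cont_left a A h K t).continuousOn
  have n1 : 0 ≤ ∫ s in t..T, ‖y s - x s‖ := intervalIntegral.integral_nonneg ht.2 fun _ _ => norm_nonneg _
  have n2 : 0 ≤ ∫ s in t..T, ‖phi s - lam s‖ :=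
    intervalIntegral.integral_nonneg ht.2 fun _ _ => norm_nonneg _
  have n3 : 0 ≤ ∫ s in t..T, ‖Dd a A h K s t‖ ^ 2 :=
    intervalIntegral.integral_nonneg ht.2 fun _ _ => sq_nonneg _
  set v := phi t - lam t with hv
  rcases eq_or_ne v 0 with h0 | h0
  · rw [h0, norm_zero]; positivity
  have i1 := duh_bwd (Z := fun s => U a h K s t) (b := fun s => a ⌊s / h⌋₊) (l := lam)
    (q := fun s => Q (x s)) (t := t) (T := T) ht.2 (U_cont_left a h K t) (U_self a h K t)
    (fun s hs => by
      obtain ⟨f1, f2, f3⟩ := floor_facts H.hh (ht.1.trans hs.1.le) (hs.2.trans_eq H.hT)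
      exact U_deriv_left a H.hh hs.1.le f1 f2 f3) (H.lc.mono sub) (cQx.mono sub)
    (fun s hs => H.ld s ⟨ht.1.trans hs.1.le, hs.2⟩) v
  have i2 := duh_bwd (Z := fun s => ex A (s - t)) (b := fun _ => A) (l := phi)
    (q := fun s => Q (y s) - G s (phi s - lam s)) (t := t) (T := T) ht.2 cXc (by simp [ex_zero])
    (fun s hs => by
      have := (ex_deriv' A (s - t)).scomp (h := fun r => r - t) s ((hasDerivAt_id s).sub_const t)
      have := this.hasDerivWithinAt (s := Ici s)
      simpa [Function.comp_def] using this) (H.pc.mono sub) (cq.mono sub)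
    (fun s hs => H.pd s ⟨ht.1.trans hs.1.le, hs.2⟩) v
  have cUv : ContinuousOn (fun s => U a h K s t v) (Icc 0 T) :=
    ((U_cont_left a h K t).clm_apply continuous_const).continuousOn
  have cEv : ContinuousOn (fun s => ex A (s - t) v) (Icc 0 T) :=
    (cXc.clm_apply continuous_const).continuousOn
  have i3 : ‖v‖ ^ 2 = (inner ℝ (ex A (T - t) v) (F (y T)) - inner ℝ (U a h K T t v) (F (x T))) +
      ∫ s in t..T, (inner ℝ (ex A (s - t) v) (Q (y s) - G s (phi s - lam s)) -
        inner ℝ (U a h K s t v) (Q (x s))) := by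
    rw [intervalIntegral.integral_sub (ii (cEv.inner cq) ht mT) (ii (cUv.inner cQx) ht mT)]
    rw [← real_inner_self_eq_norm_sq]
    nth_rewrite 2 [hv]
    rw [inner_sub_right, i1, i2, H.lT, H.pT]
    ring
  set β := Real.exp (‖A‖ * T) with hβ
  have hexp : ∀ s ∈ Icc t T, ‖ex A (s - t) v‖ ≤ β * ‖v‖ := by
    intro s hs
    refine (ex A (s - t)).le_of_opNorm_le ((ex_norm_le' A (by linarith [hs.1])).trans ?_) v
    exact Real.exp_le_exp.2 (mul_le_mul_of_nonneg_left (by linarith [hs.2, ht.1]) (norm_nonneg _))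
  have key : ∀ s ∈ Icc t T, ∀ p q r : E, inner ℝ (ex A (s - t) v) (p - r) - inner ℝ (U a h K s t v) q
      ≤ ‖v‖ * (β * (‖p - q‖ + ‖r‖) + (α * ‖Dd a A h K s t‖ ^ 2 + ‖q‖ ^ 2 / α)) := by
    intro s hs p q r
    have e1 : inner ℝ (ex A (s - t) v) (p - r) - inner ℝ (U a h K s t v) q =
        inner ℝ (ex A (s - t) v) (p - q - r) + inner ℝ (-(Dd a A h K s t v)) q := by
      simp only [Dd, _root_.sub_apply, inner_neg_left, inner_sub_left, inner_sub_right]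
      ring
    have e2 : inner ℝ (ex A (s - t) v) (p - q - r) ≤ (β * ‖v‖) * (‖p - q‖ + ‖r‖) :=
      (real_inner_le_norm _ _).trans (mul_le_mul (hexp s hs) (norm_sub_le _ _) (norm_nonneg _)
        (by positivity))
    have e3 : inner ℝ (-(Dd a A h K s t v)) q ≤ ‖v‖ * (α * ‖Dd a A h K s t‖ ^ 2 + ‖q‖ ^ 2 / α) := by
      refine (real_inner_le_norm _ _).trans ?_
      rw [norm_neg]
      calc _ ≤ (‖Dd a A h K s t‖ * ‖v‖) * ‖q‖ := by gcongr; exact (Dd a A h K s t).le_opNorm v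
        _ = ‖v‖ * (‖Dd a A h K s t‖ * ‖q‖) := by ring
        _ ≤ _ := by gcongr; exact amgm hα _ _
    rw [e1]
    linarith
  have b1 : inner ℝ (ex A (T - t) v) (F (y T)) - inner ℝ (U a h K T t v) (F (x T)) ≤
      ‖v‖ * (β * (‖F‖ * ‖y T - x T‖) + (α * ‖Dd a A h K T t‖ ^ 2 + G2 / α)) := by
    have := key T ⟨ht.2, le_rfl⟩ (F (y T)) (F (x T)) 0
    rw [sub_zero, norm_zero, add_zero, ← map_sub] at this
    refine this.trans ?_
    gcongr
    exact F.le_opNorm _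
  have cR1 : ContinuousOn (fun s => ‖Q‖ * ‖y s - x s‖ + g * ‖phi s - lam s‖) (Icc 0 T) :=
    (continuousOn_const.mul ce.norm).add (continuousOn_const.mul cr.norm)
  have cR2 : ContinuousOn (fun s => α * ‖Dd a A h K s t‖ ^ 2 + α⁻¹ * ‖Q (x s)‖ ^ 2) (Icc 0 T) :=
    (continuousOn_const.mul (cD.norm.pow 2)).add (continuousOn_const.mul (cQx.norm.pow 2))
  have b2 : ∫ s in t..T, (inner ℝ (ex A (s - t) v) (Q (y s) - G s (phi s - lam s)) -
        inner ℝ (U a h K s t v) (Q (x s))) ≤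
      ∫ s in t..T, ‖v‖ * (β * (‖Q‖ * ‖y s - x s‖ + g * ‖phi s - lam s‖) +
        (α * ‖Dd a A h K s t‖ ^ 2 + α⁻¹ * ‖Q (x s)‖ ^ 2)) := by
    refine intervalIntegral.integral_mono_on ht.2 (ii ((cEv.inner cq).sub (cUv.inner cQx)) ht mT)
      (ii (continuousOn_const.mul ((continuousOn_const.mul cR1).add cR2)) ht mT) fun s hs => ?_
    refine (key s hs _ _ _).trans ?_
    rw [← map_sub, div_eq_inv_mul]
    have k1 := Q.le_opNorm (y s - x s)
    have k2 := (G s).le_of_opNorm_le (H.Gb s (sub hs)) (phi s - lam s)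
    gcongr
  have cR1' : ContinuousOn (fun s => β * (‖Q‖ * ‖y s - x s‖ + g * ‖phi s - lam s‖)) (Icc 0 T) :=
    continuousOn_const.mul cR1
  have d1 : ContinuousOn (fun s => ‖Q‖ * ‖y s - x s‖) (Icc 0 T) := continuousOn_const.mul ce.norm
  have d2 : ContinuousOn (fun s => g * ‖phi s - lam s‖) (Icc 0 T) := continuousOn_const.mul cr.norm
  have d3 : ContinuousOn (fun s => α * ‖Dd a A h K s t‖ ^ 2) (Icc 0 T) :=
    continuousOn_const.mul (cD.norm.pow 2)
  have d4 : ContinuousOn (fun s => α⁻¹ * ‖Q (x s)‖ ^ 2) (Icc 0 T) :=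
    continuousOn_const.mul (cQx.norm.pow 2)
  rw [intervalIntegral.integral_const_mul, intervalIntegral.integral_add (ii cR1' ht mT)
    (ii cR2 ht mT), intervalIntegral.integral_const_mul,
    intervalIntegral.integral_add (ii d1 ht mT) (ii d2 ht mT),
    intervalIntegral.integral_add (ii d3 ht mT) (ii d4 ht mT), intervalIntegral.integral_const_mul,
    intervalIntegral.integral_const_mul, intervalIntegral.integral_const_mul,
    intervalIntegral.integral_const_mul] at b2
  have b3 : ∫ s in t..T, ‖Q (x s)‖ ^ 2 ≤ G2 :=
    (intervalIntegral.integral_mono_interval ht.1 ht.2 le_rfl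
      (Filter.Eventually.of_forall fun s => pow_nonneg (norm_nonneg _) 2) (ii (cQx.norm.pow 2) m0 mT)).trans g3
  have b4 := mul_le_mul_of_nonneg_left b3 (inv_nonneg.2 hα.le)
  have hv0 : 0 < ‖v‖ := norm_pos_iff.2 h0
  refine le_of_mul_le_mul_left ?_ hv0
  rw [← pow_two, i3]
  refine (add_le_add b1 b2).trans ?_
  rw [← mul_add]
  refine mul_le_mul_of_nonneg_left ?_ hv0.le
  have : 2 * G2 / α = G2 / α + α⁻¹ * G2 := by ring
  rw [this]
  linarith

end ops
end FB

open MeasureTheory Matrix Set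
namespace FB
set_option linter.unusedSectionVars false

lemma inf_am {X C u w : ℝ} (hC : 0 ≤ C) (hu : 0 ≤ u) (hw : 0 ≤ w)
    (h : ∀ α : ℝ, 0 < α → X ≤ C * (α * u ^ 2 + w ^ 2 / α)) : X ≤ C * (2 * (u * w)) := by
  have h1 : ∀ η : ℝ, 0 < η → X ≤ C * (2 * (u * w) + η * (u + w)) := by
    intro η hη
    have hα : 0 < (w + η) / (u + η) := by positivity
    refine (h _ hα).trans (mul_le_mul_of_nonneg_left ?_ hC)
    have e1 : (w + η) / (u + η) * u ^ 2 ≤ (w + η) * u := by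
      rw [div_mul_eq_mul_div, div_le_iff₀ (by positivity)]
      nlinarith [mul_nonneg (mul_nonneg (add_nonneg hw hη.le) hu) hη.le]
    have e2 : w ^ 2 / ((w + η) / (u + η)) ≤ (u + η) * w := by
      rw [div_div_eq_mul_div, div_le_iff₀ (by positivity)]
      nlinarith [mul_nonneg (mul_nonneg (add_nonneg hu hη.le) hw) hη.le]
    linarith
  refine le_of_forall_pos_le_add fun δ hδ => ?_
  have hk : 0 ≤ C * (u + w) := by positivity
  refine (h1 (δ / (C * (u + w) + 1)) (by positivity)).trans ?_
  have : δ / (C * (u + w) + 1) * (C * (u + w)) ≤ δ := by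
    rw [div_mul_eq_mul_div, div_le_iff₀ (by positivity)]
    nlinarith
  linarith

lemma gron0 {ρ : ℝ → ℝ} {T c L : ℝ} (hL : 0 ≤ L) (hρ : Continuous ρ)
    (h : ∀ t ∈ Icc 0 T, ρ t ≤ c + L * ∫ s in t..T, ρ s) (h0 : ∀ t ∈ Icc 0 T, 0 ≤ ρ t)
    {t : ℝ} (ht : t ∈ Icc 0 T) : ρ t ≤ c * Real.exp (L * T) := by
  have hT : T ∈ Icc 0 T := ⟨ht.1.trans ht.2, le_rfl⟩
  have hd : ∀ r, HasDerivAt (fun r => (c + L * ∫ s in r..T, ρ s) * Real.exp (L * r))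
      (L * (-ρ r) * Real.exp (L * r) + (c + L * ∫ s in r..T, ρ s) * (Real.exp (L * r) * L)) r := by
    intro r
    have d1 : HasDerivAt (fun r => ∫ s in r..T, ρ s) (-ρ r) r :=
      intervalIntegral.integral_hasDerivAt_left (hρ.intervalIntegrable _ _)
        (hρ.stronglyMeasurableAtFilter _ _) hρ.continuousAt
    have d2 : HasDerivAt (fun r => Real.exp (L * r)) (Real.exp (L * r) * L) r := by
      simpa using ((hasDerivAt_id r).const_mul L).exp
    exact ((d1.const_mul L).const_add c).mul d2
  have mono : MonotoneOn (fun r => (c + L * ∫ s in r..T, ρ s) * Real.exp (L * r)) (Icc 0 T) := by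
    refine monotoneOn_of_deriv_nonneg (convex_Icc 0 T)
      (fun r _ => (hd r).continuousAt.continuousWithinAt)
      (fun r _ => (hd r).differentiableAt.differentiableWithinAt) fun r hr => ?_
    rw [interior_Icc] at hr
    rw [(hd r).deriv]
    have := mul_nonneg (mul_nonneg hL (Real.exp_pos (L * r)).le)
      (sub_nonneg.2 (h r ⟨hr.1.le, hr.2.le⟩))
    linarith
  have m := mono ht hT ht.2
  simp only [intervalIntegral.integral_same, mul_zero, add_zero] at m
  refine le_trans ?_ m
  have e1 : 1 ≤ Real.exp (L * t) := Real.one_le_exp (mul_nonneg hL ht.1)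
  exact (h t ht).trans (le_mul_of_one_le_right ((h0 t ht).trans (h t ht)) e1)

lemma gron {ρ : ℝ → ℝ} {T c L : ℝ} (hL : 0 ≤ L) (hρ : ContinuousOn ρ (Icc 0 T))
    (h : ∀ t ∈ Icc 0 T, ρ t ≤ c + L * ∫ s in t..T, ρ s) (h0 : ∀ t ∈ Icc 0 T, 0 ≤ ρ t)
    {t : ℝ} (ht : t ∈ Icc 0 T) : ρ t ≤ c * Real.exp (L * T) := by
  have hT : 0 ≤ T := ht.1.trans ht.2
  set σ := IccExtend hT ((Icc 0 T).domRestrict ρ) with hσ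
  have hc : Continuous σ := continuous_IccExtend_iff.2 (continuousOn_iff_continuous_domRestrict.1 hρ)
  have he : ∀ s ∈ Icc 0 T, σ s = ρ s := fun s hs => by
    rw [hσ, IccExtend_of_mem hT _ hs]; rfl
  rw [← he t ht]
  refine gron0 hL hc (fun s hs => ?_) (fun s hs => by rw [he s hs]; exact h0 s hs) ht
  rw [he s hs]
  refine (h s hs).trans (le_of_eq ?_)
  congr 2
  refine intervalIntegral.integral_congr fun r hr => ?_
  rw [uIcc_of_le hs.2] at hr
  exact (he r ⟨hs.1.trans hr.1, hr.2⟩).symm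

section exl
variable {I : Type*} [Fintype I] {p : I → ℝ}

lemma Ex_integral {K : ℕ} {f : (Fin K → I) → ℝ → ℝ} {u v : ℝ}
    (hf : ∀ ω, IntervalIntegrable (f ω) volume u v) :
    Ex p (fun ω => ∫ s in u..v, f ω s) = ∫ s in u..v, Ex p (fun ω => f ω s) := by
  unfold Ex
  rw [intervalIntegral.integral_finsetSum fun ω _ => (hf ω).const_mul _]
  simp only [intervalIntegral.integral_const_mul]

lemma Ex_cont {K : ℕ} {f : (Fin K → I) → ℝ → ℝ} {s : Set ℝ}
    (hf : ∀ ω, ContinuousOn (f ω) s) : ContinuousOn (fun t => Ex p (fun ω => f ω t)) s := by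
  unfold Ex
  exact continuousOn_finsetSum _ fun ω _ => continuousOn_const.mul (hf ω)

/-- integrated bound -/
lemma Ex_int_le {K : ℕ} {f : (Fin K → I) → ℝ → ℝ} {u v c : ℝ} (huv : u ≤ v)
    (hf : ∀ ω, ContinuousOn (f ω) (Icc u v)) (hb : ∀ s ∈ Icc u v, Ex p (fun ω => f ω s) ≤ c) :
    Ex p (fun ω => ∫ s in u..v, f ω s) ≤ (v - u) * c := by
  rw [Ex_integral fun ω => ContinuousOn.intervalIntegrable (by rw [uIcc_of_le huv]; exact hf ω)]
  have h1 : ∫ s in u..v, Ex p (fun ω => f ω s) ≤ ∫ s in u..v, c :=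
    intervalIntegral.integral_mono_on huv
      (ContinuousOn.intervalIntegrable (by rw [uIcc_of_le huv]; exact Ex_cont hf))
      (by simp) hb
  simpa using h1

end exl

section ops
variable {E : Type*} [NormedAddCommGroup E] [InnerProductSpace ℝ E] [FiniteDimensional ℝ E]

lemma op_le_basis (D : E →L[ℝ] E) :
    ‖D‖ ^ 2 ≤ ∑ i, ‖D (stdOrthonormalBasis ℝ E i)‖ ^ 2 := by
  set b := stdOrthonormalBasis ℝ E
  have h1 : ‖D‖ ≤ Real.sqrt (∑ i, ‖D (b i)‖ ^ 2) := by
    refine D.opNorm_le_bound (Real.sqrt_nonneg _) fun v => ?_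
    have e1 : D v = ∑ i, inner ℝ (b i) v • D (b i) := by
      conv_lhs => rw [← b.sum_repr' v]
      simp
    have e2 : ‖v‖ = Real.sqrt (∑ i, ‖inner ℝ (b i) v‖ ^ 2) := by
      rw [b.sum_sq_norm_inner_right, Real.sqrt_sq (norm_nonneg _)]
    rw [e1, e2, mul_comm]
    refine (norm_sum_le _ _).trans ?_
    simp only [norm_smul]
    exact Real.sum_mul_le_sqrt_mul_sqrt _ _ _
  calc ‖D‖ ^ 2 ≤ Real.sqrt (∑ i, ‖D (b i)‖ ^ 2) ^ 2 := by gcongr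
    _ = _ := Real.sq_sqrt (by positivity)

noncomputable def cS (A : E →L[ℝ] E) (T : ℝ) : ℝ :=
  Real.exp (3 * Real.exp (‖A‖ * T) ^ 3 * T) * (Real.exp (‖A‖ * T) ^ 2 * Module.finrank ℝ E)

lemma cS_nonneg (A : E →L[ℝ] E) (T : ℝ) : 0 ≤ cS A T := by unfold cS; positivity

variable {I : Type*} [Fintype I] {p : I → ℝ} 

lemma stochD (hp : ∀ i, 0 ≤ p i) (hp1 : ∑ i, p i = 1)
    {a : I → E →L[ℝ] E} {A : E →L[ℝ] E} (hA : ∑ i, p i • a i = A) {μ : ℝ} (hμ0 : 0 ≤ μ)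
    (hμ : ∀ i x, inner ℝ (a i x) x ≤ μ * ‖x‖ ^ 2) {h T : ℝ} (hh : 0 < h)
    (hV : h * (∑ i, p i * ‖A - a i‖ ^ 2) ≤ 1) {K : ℕ} (hT : T = K * h)
    {s t : ℝ} (ht : 0 ≤ t) (hts : t ≤ s) (hs : s ≤ T) :
    Ex p (fun ω : Fin K → I => ‖Dd (sq a ω) A h K s t‖ ^ 2) ≤
      cS A T * Real.exp (2 * μ * T) * (h * ∑ i, p i * ‖A - a i‖ ^ 2) := by
  have hsK : s ≤ K * h := hs.trans_eq hT
  have hsum : ∑ k ∈ Finset.range K, (cl h k s - cl h k t) = s - t := by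
    rw [Finset.sum_sub_distrib, cl_sum h K (ht.trans hts) hsK, cl_sum h K ht (hts.trans hsK)]
  set b := stdOrthonormalBasis ℝ E
  set V := h * ∑ i, p i * ‖A - a i‖ ^ 2 with hVd
  have hV0 : 0 ≤ V := mul_nonneg hh.le (Finset.sum_nonneg fun i _ => mul_nonneg (hp i) (sq_nonneg _))
  have h1 : ∀ i, Ex p (fun ω : Fin K → I => ‖Dd (sq a ω) A h K s t (b i)‖ ^ 2) ≤
      Real.exp (2 * μ * T) * Real.exp (3 * Real.exp (‖A‖ * T) ^ 3 * T) *
        (V * Real.exp (‖A‖ * T) ^ 2) := by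
    intro i
    have := stoch hp hp1 hA hμ0 hμ (T := T) hV (δ := fun k => cl h k s - cl h k t)
      (fun k => (cl_mono hh k hts).1) (fun k => (cl_mono hh k hts).2) (b i) K
      (by rw [hsum]; linarith)
    rw [hsum, b.orthonormal.1 i, one_pow, mul_one] at this
    refine this.trans ?_
    have q1 : Real.exp (2 * μ * (s - t)) ≤ Real.exp (2 * μ * T) := by
      gcongr; linarith
    have q2 : Real.exp (3 * Real.exp (‖A‖ * T) ^ 3 * (s - t)) - 1 ≤
        Real.exp (3 * Real.exp (‖A‖ * T) ^ 3 * T) := by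
      have : Real.exp (3 * Real.exp (‖A‖ * T) ^ 3 * (s - t)) ≤
        Real.exp (3 * Real.exp (‖A‖ * T) ^ 3 * T) := by gcongr; linarith
      linarith
    have q3 : 0 ≤ Real.exp (3 * Real.exp (‖A‖ * T) ^ 3 * (s - t)) - 1 := by
      have : 0 ≤ s - t := by linarith
      exact sub_nonneg.2 (Real.one_le_exp (by positivity))
    gcongr
  calc _ ≤ Ex p (fun ω : Fin K → I => ∑ i, ‖Dd (sq a ω) A h K s t (b i)‖ ^ 2) :=
        Ex_mono hp fun ω => op_le_basis _
    _ = ∑ i, Ex p (fun ω : Fin K → I => ‖Dd (sq a ω) A h K s t (b i)‖ ^ 2) := Ex_sum _ _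
    _ ≤ ∑ i : Fin (Module.finrank ℝ E), Real.exp (2 * μ * T) *
          Real.exp (3 * Real.exp (‖A‖ * T) ^ 3 * T) * (V * Real.exp (‖A‖ * T) ^ 2) :=
        Finset.sum_le_sum fun i _ => h1 i
    _ = _ := by
        rw [Finset.sum_const, Finset.card_univ, Fintype.card_fin, nsmul_eq_mul, cS]; ring

/-- final constant -/
noncomputable def cR (A S Q F : E →L[ℝ] E) (T g : ℝ) : ℝ :=
  (Real.exp (‖A‖ * T) * ‖F‖ + Real.exp (‖A‖ * T) * ‖Q‖ * T + 1) * (2 * (1 + T)) *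
    Real.exp (Real.exp (‖A‖ * T) * g * T) * (2 * (Real.sqrt (cS A T) * Real.sqrt (cG S Q F T)))

lemma core (hp : ∀ i, 0 ≤ p i) (hp1 : ∑ i, p i = 1)
    {a : I → E →L[ℝ] E} {A S Q F : E →L[ℝ] E} (hA : ∑ i, p i • a i = A) {μ : ℝ} (hμ0 : 0 ≤ μ)
    (hμ : ∀ i x, inner ℝ (a i x) x ≤ μ * ‖x‖ ^ 2) {h T : ℝ} (hh : 0 < h)
    (hV : h * (∑ i, p i * ‖A - a i‖ ^ 2) ≤ 1) {K : ℕ} (hT : T = K * h) (hT0 : 0 < T)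
    {G : ℝ → E →L[ℝ] E} {g : ℝ} {x lam y phi : (Fin K → I) → ℝ → E} {xb : E}
    (H : ∀ ω, PathSys (sq a ω) A S Q F h K T G g μ (x ω) (lam ω) (y ω) (phi ω))
    (hx : ∀ ω, x ω 0 = xb) {t : ℝ} (ht : t ∈ Icc 0 T) (hg : 0 ≤ g) :
    Ex p (fun ω => ‖phi ω t - lam ω t‖) ≤ cR A S Q F T g *
      (Real.exp (2 * μ * T) * Real.sqrt (h * ∑ i, p i * ‖A - a i‖ ^ 2) * ‖xb‖) := by
  set V := h * ∑ i, p i * ‖A - a i‖ ^ 2 with hVd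
  have hV0 : 0 ≤ V := mul_nonneg hh.le (Finset.sum_nonneg fun i _ => mul_nonneg (hp i) (sq_nonneg _))
  set e2 := cS A T * Real.exp (2 * μ * T) * V with he2
  set G2 := cG S Q F T * (Real.exp (2 * μ * T) * ‖xb‖ ^ 2) with hG2
  have hcG : 0 ≤ cG S Q F T := by unfold cG; positivity
  have hcS := cS_nonneg A T
  have he20 : 0 ≤ e2 := by positivity
  have hG20 : 0 ≤ G2 := by positivity
  have hG : ∀ ω, cG S Q F T * (Real.exp (2 * μ * T) * ‖x ω 0‖ ^ 2) ≤ G2 := fun ω => by rw [hx]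
  set β := Real.exp (‖A‖ * T) with hβ
  have hβ0 : 0 ≤ β := (Real.exp_pos _).le
  set k := β * ‖F‖ + β * ‖Q‖ * T + 1 with hk
  have hk0 : 0 ≤ k := by positivity
  have hD : ∀ {s t : ℝ}, 0 ≤ t → t ≤ s → s ≤ T →
      Ex p (fun ω : Fin K → I => ‖Dd (sq a ω) A h K s t‖ ^ 2) ≤ e2 := fun h1 h2 h3 =>
    stochD hp hp1 hA hμ0 hμ hh hV hT h1 h2 h3
  have main : ∀ α : ℝ, 0 < α → Ex p (fun ω => ‖phi ω t - lam ω t‖) ≤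
      (k * (2 * (1 + T)) * Real.exp (β * g * T)) *
        (α * Real.sqrt e2 ^ 2 + Real.sqrt G2 ^ 2 / α) := by
    intro α hα
    rw [Real.sq_sqrt he20, Real.sq_sqrt hG20]
    set Ψ := α * e2 + G2 / α with hΨ
    have hΨ0 : 0 ≤ Ψ := by positivity
    have n1 : 0 ≤ α * e2 := by positivity
    have n2 : 0 ≤ G2 / α := by positivity
    have arith : ∀ d, d ≤ T → α * e2 + α * (d * e2) + 2 * G2 / α ≤ 2 * (1 + T) * Ψ := by
      intro d hd
      have : α * (d * e2) ≤ α * (T * e2) := by gcongr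
      have : 2 * (1 + T) * Ψ = α * e2 + α * (T * e2) + 2 * G2 / α + (α * e2 + T * (α * e2)) +
        2 * (T * (G2 / α)) := by rw [hΨ]; ring
      have := mul_nonneg hT0.le n1
      have := mul_nonneg hT0.le n2
      linarith
    have he : ∀ s ∈ Icc 0 T, Ex p (fun ω => ‖y ω s - x ω s‖) ≤ 2 * (1 + T) * Ψ := by
      intro s hs
      refine (Ex_mono hp fun ω => path_e (H ω) (hG ω) hα hs).trans ?_
      rw [Ex_add, Ex_add, Ex_mul, Ex_mul, Ex_const hp1]
      refine le_trans ?_ (arith (s - 0) (by linarith [hs.2]))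
      have q1 := hD le_rfl hs.1 hs.2
      have q2 := Ex_int_le (p := p) (f := fun ω r => ‖Dd (sq a ω) A h K s r‖ ^ 2) (c := e2) hs.1
        (fun ω => ((Dd_cont_right _ A h K s).norm.pow 2).continuousOn)
        (fun r hr => hD hr.1 hr.2 hs.2)
      gcongr
    have cr : ∀ ω, ContinuousOn (fun s => ‖phi ω s - lam ω s‖) (Icc 0 T) :=
      fun ω => ((H ω).pc.sub (H ω).lc).norm
    have ce : ∀ ω, ContinuousOn (fun s => ‖y ω s - x ω s‖) (Icc 0 T) :=
      fun ω => ((H ω).yc.sub (H ω).xc).norm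
    have mT : T ∈ Icc 0 T := ⟨hT0.le, le_rfl⟩
    have gr := gron (ρ := fun s => Ex p (fun ω => ‖phi ω s - lam ω s‖)) (T := T)
      (c := k * (2 * (1 + T) * Ψ)) (L := β * g) (by positivity) (Ex_cont cr) ?_
      (fun s _ => Ex_nonneg hp fun ω => norm_nonneg _) ht
    · refine gr.trans (le_of_eq ?_)
      ring
    intro s hs
    refine (Ex_mono hp fun ω => path_r (H ω) (hG ω) hα hs).trans ?_
    rw [Ex_add, Ex_add, Ex_mul, Ex_mul, Ex_mul, Ex_add, Ex_mul, Ex_mul, Ex_add, Ex_add, Ex_mul,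
      Ex_mul, Ex_const hp1]
    rw [Ex_integral (f := fun ω r => ‖phi ω r - lam ω r‖) fun ω => ii (cr ω) hs mT]
    have q0 := he T mT
    have q1 := hD hs.1 hs.2 le_rfl
    have q2 := Ex_int_le (p := p) (f := fun ω r => ‖Dd (sq a ω) A h K r s‖ ^ 2) (c := e2) hs.2
      (fun ω => ((Dd_cont_left _ A h K s).norm.pow 2).continuousOn)
      (fun r hr => hD hs.1 hr.1 hr.2)
    have q3 := Ex_int_le (p := p) (f := fun ω r => ‖y ω r - x ω r‖) (c := 2 * (1 + T) * Ψ) hs.2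
      (fun ω => (ce ω).mono (Icc_subset_Icc_left hs.1))
      (fun r hr => he r ⟨hs.1.trans hr.1, hr.2⟩)
    have q4 : Ex p (fun ω => ∫ r in s..T, ‖y ω r - x ω r‖) ≤ T * (2 * (1 + T) * Ψ) :=
      q3.trans (by gcongr; linarith [hs.1])
    have q5 := arith (T - s) (by linarith [hs.1])
    calc _ ≤ β * (‖F‖ * (2 * (1 + T) * Ψ)) + β * (‖Q‖ * (T * (2 * (1 + T) * Ψ)) +
          g * ∫ r in s..T, Ex p (fun ω => ‖phi ω r - lam ω r‖)) +
          (α * e2 + α * ((T - s) * e2) + 2 * G2 / α) := by gcongr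
      _ ≤ β * (‖F‖ * (2 * (1 + T) * Ψ)) + β * (‖Q‖ * (T * (2 * (1 + T) * Ψ)) +
          g * ∫ r in s..T, Ex p (fun ω => ‖phi ω r - lam ω r‖)) + 2 * (1 + T) * Ψ := by gcongr
      _ = _ := by rw [hk]; ring
  have fin := inf_am (by positivity) (Real.sqrt_nonneg _) (Real.sqrt_nonneg _) main
  refine fin.trans (le_of_eq ?_)
  have s0 : Real.exp (2 * μ * T) = Real.exp (μ * T) ^ 2 := by
    rw [← Real.exp_nat_mul]; congr 1; push_cast; ring
  have s1 : Real.sqrt e2 = Real.sqrt (cS A T) * Real.exp (μ * T) * Real.sqrt V := by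
    rw [he2, Real.sqrt_mul (by positivity), Real.sqrt_mul hcS, s0, Real.sqrt_sq (Real.exp_pos _).le]
  have s2 : Real.sqrt G2 = Real.sqrt (cG S Q F T) * (Real.exp (μ * T) * ‖xb‖) := by
    rw [hG2, Real.sqrt_mul hcG, s0, ← mul_pow, Real.sqrt_sq (by positivity)]
  rw [s1, s2, s0, cR]
  ring

end ops
end FB


open MeasureTheory Matrix Set


namespace FB
set_option linter.unusedSectionVars false

lemma rd {X : Type*} [NormedAddCommGroup X] [NormedSpace ℝ X] [CompleteSpace X] {h T : ℝ} {K : ℕ}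
    (hh : 0 < h) (hT : T = K * h) (hT0 : 0 < T) {f : ℝ → X} {Φ : ℕ → ℝ → X}
    (hΦ : ∀ k < K, ContinuousOn (Φ k) (Icc 0 T))
    (hf : ∀ s ∈ Icc 0 T, f s = Φ (min ⌊s / h⌋₊ (K - 1)) s) :
    IntervalIntegrable f volume 0 T ∧
      ∀ t ∈ Ico 0 T, HasDerivWithinAt (fun t => ∫ s in (0 : ℝ)..t, f s) (f t) (Ici t) t := by
  have hK : 0 < K := by
    rcases Nat.eq_zero_or_pos K with h0 | h0
    · subst h0; simp at hT; linarith
    · exact h0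
  have hmeas : Measurable fun s : ℝ => min ⌊s / h⌋₊ (K - 1) :=
    (Nat.measurable_floor.comp (measurable_id.div_const h)).min measurable_const
  have I1 : IntegrableOn f (Icc 0 T) := by
    have h1 : IntegrableOn (fun s => ∑ k ∈ Finset.range K,
        ((fun s : ℝ => min ⌊s / h⌋₊ (K - 1)) ⁻¹' {k}).indicator (Φ k) s) (Icc 0 T) := by
      refine integrable_finsetSum _ fun k hk => ?_
      exact ((hΦ k (Finset.mem_range.1 hk)).integrableOn_Icc).indicator
        (hmeas (measurableSet_singleton k))
    refine h1.congr_fun (fun s hs => ?_) measurableSet_Icc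
    rw [hf s hs]
    simp only [indicator, mem_preimage, mem_singleton_iff]
    rw [Finset.sum_ite_eq, if_pos]
    exact Finset.mem_range.2 (lt_of_le_of_lt (min_le_right _ _) (Nat.sub_lt hK one_pos))
  have I2 : IntervalIntegrable f volume 0 T :=
    (intervalIntegrable_iff_integrableOn_Icc_of_le hT0.le).2 I1
  refine ⟨I2, fun t ht => ?_⟩
  obtain ⟨f1, f2, f3⟩ := floor_facts hh ht.1 (ht.2.trans_eq hT)
  have hev : ∀ s ∈ Ico t ((⌊t / h⌋₊ + 1) * h), s ∈ Icc 0 T → f s = Φ ⌊t / h⌋₊ s := by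
    intro s hs hs'
    have : ⌊s / h⌋₊ = ⌊t / h⌋₊ := by
      rw [Nat.floor_eq_iff (div_nonneg hs'.1 hh.le)]
      constructor
      · rw [le_div_iff₀ hh]; exact f2.trans hs.1
      · rw [div_lt_iff₀ hh]; exact hs.2
    rw [hf s hs', this, min_eq_left (by omega)]
  refine intervalIntegral.integral_hasDerivWithinAt_right (s := Ici t) (t := Ioi t)
    (I2.mono_set ?_) ⟨Icc 0 T, ?_, I1.aestronglyMeasurable⟩ ?_
  · rw [uIcc_of_le ht.1, uIcc_of_le hT0.le]; exact Icc_subset_Icc_right ht.2.le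
  · exact Filter.mem_of_superset (Ioo_mem_nhdsGT ht.2) fun s hs => ⟨ht.1.trans hs.1.le, hs.2.le⟩
  · have c1 : ContinuousWithinAt (Φ ⌊t / h⌋₊) (Ioi t) t := by
      refine ((hΦ _ f1) t ⟨ht.1, ht.2.le⟩).mono_of_mem_nhdsWithin ?_
      exact Filter.mem_of_superset (Ioo_mem_nhdsGT ht.2) fun s hs => ⟨ht.1.trans hs.1.le, hs.2.le⟩
    refine c1.congr_of_eventuallyEq ?_ (hev t ⟨le_rfl, f3⟩ ⟨ht.1, ht.2.le⟩)
    filter_upwards [Ioo_mem_nhdsGT f3, Ioo_mem_nhdsGT ht.2] with s hs hs'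
    exact hev s ⟨hs.1.le, hs.2⟩ ⟨ht.1.trans hs'.1.le, hs'.2.le⟩

lemma rd_fwd {X : Type*} [NormedAddCommGroup X] [NormedSpace ℝ X] [CompleteSpace X] {h T : ℝ} {K : ℕ}
    (hh : 0 < h) (hT : T = K * h) (hT0 : 0 < T) {f w : ℝ → X} {c : X} {Φ : ℕ → ℝ → X}
    (hΦ : ∀ k < K, ContinuousOn (Φ k) (Icc 0 T))
    (hf : ∀ s ∈ Icc 0 T, f s = Φ (min ⌊s / h⌋₊ (K - 1)) s)
    (hw : ∀ t ∈ Icc 0 T, w t = c + ∫ s in (0 : ℝ)..t, f s) {t : ℝ} (ht : t ∈ Ico 0 T) :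
    HasDerivWithinAt w (f t) (Ici t) t := by
  have h1 := ((rd hh hT hT0 hΦ hf).2 t ht).const_add c
  refine h1.congr_of_eventuallyEq ?_ (hw t ⟨ht.1, ht.2.le⟩)
  filter_upwards [Icc_mem_nhdsGE ht.2] with s hs
  exact hw s ⟨ht.1.trans hs.1, hs.2⟩

lemma rd_bwd {X : Type*} [NormedAddCommGroup X] [NormedSpace ℝ X] [CompleteSpace X] {h T : ℝ} {K : ℕ}
    (hh : 0 < h) (hT : T = K * h) (hT0 : 0 < T) {f w : ℝ → X} {c : X} {Φ : ℕ → ℝ → X}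
    (hΦ : ∀ k < K, ContinuousOn (Φ k) (Icc 0 T))
    (hf : ∀ s ∈ Icc 0 T, f s = Φ (min ⌊s / h⌋₊ (K - 1)) s)
    (hw : ∀ t ∈ Icc 0 T, w t = c + ∫ s in t..T, f s) {t : ℝ} (ht : t ∈ Ico 0 T) :
    HasDerivWithinAt w (-(f t)) (Ici t) t := by
  obtain ⟨I, d⟩ := rd hh hT hT0 hΦ hf
  have h1 := (d t ht).const_sub (c + ∫ s in (0 : ℝ)..T, f s)
  have e : ∀ s ∈ Icc 0 T, w s = (c + ∫ s in (0 : ℝ)..T, f s) - ∫ r in (0 : ℝ)..s, f r := by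
    intro s hs
    rw [hw s hs, ← intervalIntegral.integral_interval_sub_left I
      (I.mono_set (by rw [uIcc_of_le hs.1, uIcc_of_le hT0.le]; exact Icc_subset_Icc_right hs.2))]
    abel
  refine h1.congr_of_eventuallyEq ?_ (e t ⟨ht.1, ht.2.le⟩)
  filter_upwards [Icc_mem_nhdsGE ht.2] with s hs
  exact e s ⟨ht.1.trans hs.1, hs.2⟩

section mat
variable {n r q : ℕ}

/-- vectors as Euclidean vectors -/
noncomputable def vL (n : ℕ) : (Fin n → ℝ) →L[ℝ] EuclideanSpace ℝ (Fin n) :=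
  ((EuclideanSpace.equiv (Fin n) ℝ).symm : (Fin n → ℝ) →L[ℝ] EuclideanSpace ℝ (Fin n))

lemma vL_eq (v : Fin n → ℝ) : vL n v = WithLp.toLp 2 v := rfl

lemma vL_surj (x : EuclideanSpace ℝ (Fin n)) : ∃ v, vL n v = x :=
  ⟨x.ofLp, rfl⟩

lemma eN_eq (v : Fin n → ℝ) : eN v = ‖vL n v‖ := by
  rw [EuclideanSpace.norm_eq]
  simp [eN, vL_eq]

lemma clm_vL (A : Matrix (Fin n) (Fin r) ℝ) (v : Fin r → ℝ) : clm A (vL r v) = vL n (A *ᵥ v) := by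
  simp only [clm, vL_eq]
  exact Matrix.toLpLin_toLp 2 2 A v

lemma inner_vL (v w : Fin n → ℝ) : inner ℝ (vL n v) (vL n w) = w ⬝ᵥ v := by
  rw [vL_eq, vL_eq, EuclideanSpace.inner_toLp_toLp]; simp

noncomputable def clmL (n r : ℕ) : Matrix (Fin n) (Fin r) ℝ →L[ℝ]
    (EuclideanSpace ℝ (Fin r) →L[ℝ] EuclideanSpace ℝ (Fin n)) :=
  LinearMap.toContinuousLinearMap
    ((LinearMap.toContinuousLinearMap (𝕜 := ℝ) (E := EuclideanSpace ℝ (Fin r))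
      (F' := EuclideanSpace ℝ (Fin n))).toLinearMap ∘ₗ
      (Matrix.toEuclideanLin (𝕜 := ℝ) (m := Fin n) (n := Fin r)).toLinearMap)

lemma clmL_eq (A : Matrix (Fin n) (Fin r) ℝ) : clmL n r A = clm A := rfl

lemma clm_mul (A : Matrix (Fin n) (Fin r) ℝ) (B : Matrix (Fin r) (Fin q) ℝ)
    (x : EuclideanSpace ℝ (Fin q)) : clm (A * B) x = clm A (clm B x) := by
  obtain ⟨v, rfl⟩ := vL_surj x
  rw [clm_vL, clm_vL, clm_vL, Matrix.mulVec_mulVec]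

lemma clm_add (A B : Matrix (Fin n) (Fin r) ℝ) : clm (A + B) = clm A + clm B :=
  map_add (clmL n r) A B

lemma clm_sub (A B : Matrix (Fin n) (Fin r) ℝ) : clm (A - B) = clm A - clm B :=
  map_sub (clmL n r) A B

lemma clm_neg (A : Matrix (Fin n) (Fin r) ℝ) : clm (-A) = -clm A :=
  map_neg (clmL n r) A

lemma clm_tr (A : Matrix (Fin n) (Fin r) ℝ) :
    clm Aᵀ = ContinuousLinearMap.adjoint (clm A) := by
  refine (ContinuousLinearMap.eq_adjoint_iff _ _).2 fun x y => ?_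
  obtain ⟨v, rfl⟩ := vL_surj x
  obtain ⟨w, rfl⟩ := vL_surj y
  rw [clm_vL, clm_vL, inner_vL, inner_vL, Matrix.dotProduct_mulVec, Matrix.vecMul_transpose]

lemma clm_psd {A : Matrix (Fin n) (Fin n) ℝ} (hA : A.PosSemidef) (x : EuclideanSpace ℝ (Fin n)) :
    0 ≤ inner ℝ (clm A x) x := by
  obtain ⟨v, rfl⟩ := vL_surj x
  rw [clm_vL, inner_vL]
  simpa using hA.dotProduct_mulVec_nonneg v

lemma clm_sym {A : Matrix (Fin n) (Fin n) ℝ} (hA : A.PosSemidef) (x y : EuclideanSpace ℝ (Fin n)) :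
    inner ℝ (clm A x) y = inner ℝ x (clm A y) := by
  have h1 : Aᵀ = A := by
    rw [← Matrix.conjTranspose_eq_transpose_of_trivial]; exact hA.1.eq
  conv_rhs => rw [← h1, clm_tr, ContinuousLinearMap.adjoint_inner_right]

lemma mean_batch {M : ℕ} (As : Fin M → Matrix (Fin n) (Fin n) ℝ)
    (S : Fin (2 ^ M) → Finset (Fin M)) (p : Fin (2 ^ M) → ℝ) (hpi : ∀ i, 0 < piP S p i) :
    ∑ ω, p ω • batchM As S p ω = ∑ j, As j := by
  have h1 : ∀ ω, p ω • batchM As S p ω =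
      ∑ j, (if j ∈ S ω then p ω else 0) • ((piP S p j)⁻¹ • As j) := by
    intro ω
    rw [batchM, Finset.smul_sum]
    simp only [ite_smul, zero_smul]
    rw [Finset.sum_ite_mem, Finset.univ_inter]
  rw [Finset.sum_congr rfl fun ω _ => h1 ω, Finset.sum_comm]
  refine Finset.sum_congr rfl fun j _ => ?_
  rw [← Finset.sum_smul, smul_smul]
  have : ∑ ω, (if j ∈ S ω then p ω else 0) = piP S p j := by
    rw [piP, Finset.sum_filter]
  rw [this, mul_inv_cancel₀ (hpi j).ne', one_smul]

end mat
end FB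


open MeasureTheory Matrix Set


namespace FB
set_option linter.unusedSectionVars false

section
variable {n r q : ℕ}

lemma cMul {f : ℝ → Matrix (Fin n) (Fin r) ℝ} {g : ℝ → Matrix (Fin r) (Fin q) ℝ} {s : Set ℝ}
    (hf : ContinuousOn f s) (hg : ContinuousOn g s) : ContinuousOn (fun t => f t * g t) s := by
  have h1 : Continuous fun z : Matrix (Fin n) (Fin r) ℝ × Matrix (Fin r) (Fin q) ℝ => z.1 * z.2 :=
    continuous_fst.matrix_mul continuous_snd
  exact h1.comp_continuousOn (hf.prodMk hg)

lemma cMulVec {f : ℝ → Matrix (Fin n) (Fin r) ℝ} {g : ℝ → Fin r → ℝ} {s : Set ℝ}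
    (hf : ContinuousOn f s) (hg : ContinuousOn g s) : ContinuousOn (fun t => f t *ᵥ g t) s := by
  have h1 : Continuous fun z : Matrix (Fin n) (Fin r) ℝ × (Fin r → ℝ) => z.1 *ᵥ z.2 :=
    continuous_fst.matrix_mulVec continuous_snd
  exact h1.comp_continuousOn (hf.prodMk hg)

lemma Rhat_psd {m : ℕ} (B : Matrix (Fin n) (Fin m) ℝ) {W : Matrix (Fin m) (Fin m) ℝ} (hW : W.PosDef) :
    (B * W⁻¹ * Bᵀ).PosSemidef := by
  have := hW.inv.posSemidef.mul_mul_conjTranspose_same B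
  rwa [Matrix.conjTranspose_eq_transpose_of_trivial] at this

/-- batch as function of interval index -/
noncomputable def aM {M K : ℕ} (As : Fin M → Matrix (Fin n) (Fin n) ℝ)
    (S : Fin (2 ^ M) → Finset (Fin M)) (p : Fin (2 ^ M) → ℝ)
    (ω : Fin K → Fin (2 ^ M)) (k : ℕ) : Matrix (Fin n) (Fin n) ℝ :=
  if hk : k < K then batchM As S p (ω ⟨k, hk⟩) else 0

lemma AR_aM {M K : ℕ} (As : Fin M → Matrix (Fin n) (Fin n) ℝ)
    (S : Fin (2 ^ M) → Finset (Fin M)) (p : Fin (2 ^ M) → ℝ) (h : ℝ)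
    (ω : Fin K → Fin (2 ^ M)) (hK : 0 < K) (t : ℝ) :
    AR As S p h ω t = aM As S p ω (min ⌊t / h⌋₊ (K - 1)) := by
  have : min ⌊t / h⌋₊ (K - 1) < K := lt_of_le_of_lt (min_le_right _ _) (Nat.sub_lt hK one_pos)
  rw [AR, aM, dif_pos hK, dif_pos this]

lemma clm_aM {M K : ℕ} (As : Fin M → Matrix (Fin n) (Fin n) ℝ)
    (S : Fin (2 ^ M) → Finset (Fin M)) (p : Fin (2 ^ M) → ℝ)
    (ω : Fin K → Fin (2 ^ M)) (k : ℕ) :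
    clm (aM As S p ω k) = sq (fun i => clm (batchM As S p i)) ω k := by
  unfold aM sq
  split_ifs
  · rfl
  · exact map_zero (clmL n n)

lemma sys {m : ℕ} {A : Matrix (Fin n) (Fin n) ℝ} {B : Matrix (Fin n) (Fin m) ℝ}
    {Q : Matrix (Fin n) (Fin n) ℝ} {W : Matrix (Fin m) (Fin m) ℝ}
    {F : Matrix (Fin n) (Fin n) ℝ}
    (hQ : Q.PosSemidef) (hW : W.PosDef) (hF : F.PosSemidef)
    {T : ℝ} (hT : 0 < T) {κ : ℝ}
    {PT : ℝ → Matrix (Fin n) (Fin n) ℝ}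
    (hPT : ∀ t ∈ Icc (0 : ℝ) T,
      HasDerivAt PT (-(Aᵀ * PT t + PT t * A - PT t * B * W⁻¹ * Bᵀ * PT t + Q)) t)
    (hPTF : PT T = F)
    (hPTκ : ∀ t ∈ Icc (0 : ℝ) T, opN (PT t) ≤ κ)
    {M K : ℕ} {As : Fin M → Matrix (Fin n) (Fin n) ℝ}
    {S : Fin (2 ^ M) → Finset (Fin M)} {p : Fin (2 ^ M) → ℝ} {h : ℝ} {μ : ℝ}
    (hh : 0 < h) (hTK : T = K * h) (hμ0 : 0 ≤ μ)
    (hμ : ∀ i x, inner ℝ (clm (batchM As S p i) x) x ≤ μ * ‖x‖ ^ 2)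
    (ω : Fin K → Fin (2 ^ M))
    {P : ℝ → Matrix (Fin n) (Fin n) ℝ} (Pc : ContinuousOn P (Icc 0 T))
    (hP : ∀ t ∈ Icc (0 : ℝ) T,
            P t = F + ∫ s in t..T, ((AR As S p h ω s)ᵀ * P s + P s * AR As S p h ω s -
              P s * B * W⁻¹ * Bᵀ * P s + Q))
    {xb : Fin n → ℝ} {x y : ℝ → Fin n → ℝ} (xc : ContinuousOn x (Icc 0 T))
    (hx : ∀ t ∈ Icc (0 : ℝ) T,
                x t = xb + ∫ s in (0 : ℝ)..t, ((AR As S p h ω s - B * W⁻¹ * Bᵀ * P s) *ᵥ x s))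
    (yc : ContinuousOn y (Icc 0 T))
    (hy : ∀ t ∈ Icc (0 : ℝ) T,
                y t = xb + ∫ s in (0 : ℝ)..t, (A *ᵥ y s - (B * W⁻¹ * Bᵀ * P s) *ᵥ x s)) :
    PathSys (sq (fun i => clm (batchM As S p i)) ω) (clm A) (clm (B * W⁻¹ * Bᵀ)) (clm Q) (clm F)
      h K T (fun t => clm (PT t) ∘L clm (B * W⁻¹ * Bᵀ)) (κ * ‖clm (B * W⁻¹ * Bᵀ)‖) μ
      (fun t => vL n (x t)) (fun t => clm (P t) (vL n (x t)))
      (fun t => vL n (y t)) (fun t => clm (PT t) (vL n (y t))) := by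
  have hK : 0 < K := by
    rcases Nat.eq_zero_or_pos K with h0 | h0
    · subst h0; simp at hTK; linarith
    · exact h0
  have hAR : ∀ t, AR As S p h ω t = aM As S p ω (min ⌊t / h⌋₊ (K - 1)) :=
    fun t => AR_aM As S p h ω hK t
  have hAt : ∀ t ∈ Ico 0 T, clm (AR As S p h ω t) =
      sq (fun i => clm (batchM As S p i)) ω ⌊t / h⌋₊ := by
    intro t ht
    have := (floor_facts hh ht.1 (ht.2.trans_eq hTK)).1
    rw [hAR, min_eq_left (by omega), clm_aM]
  have assoc : ∀ X : Matrix (Fin n) (Fin n) ℝ, X * B * W⁻¹ * Bᵀ = X * (B * W⁻¹ * Bᵀ) := by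
    intro X; simp only [Matrix.mul_assoc]
  simp only [assoc] at hPT hP
  set R := B * W⁻¹ * Bᵀ with hR
  have hR0 : R.PosSemidef := Rhat_psd B hW
  have PTc : ContinuousOn PT (Icc 0 T) := fun t ht => (hPT t ht).continuousAt.continuousWithinAt
  have cP : ContinuousOn (fun t => clm (P t)) (Icc 0 T) :=
    (clmL n n).continuous.comp_continuousOn Pc
  have cPT : ContinuousOn (fun t => clm (PT t)) (Icc 0 T) :=
    (clmL n n).continuous.comp_continuousOn PTc
  have cx : ContinuousOn (fun t => vL n (x t)) (Icc 0 T) := (vL n).continuous.comp_continuousOn xc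
  have cy : ContinuousOn (fun t => vL n (y t)) (Icc 0 T) := (vL n).continuous.comp_continuousOn yc
  have dx0 : ∀ t ∈ Ico 0 T, HasDerivWithinAt x
      ((AR As S p h ω t - R * P t) *ᵥ x t) (Ici t) t := by
    intro t ht
    refine rd_fwd hh hTK hT (Φ := fun k s => (aM As S p ω k - R * P s) *ᵥ x s)
      (f := fun s => (AR As S p h ω s - R * P s) *ᵥ x s) ?_ ?_ hx ht
    · intro k _
      exact cMulVec (continuousOn_const.sub (cMul continuousOn_const Pc)) xc
    · intro s _; simp only [hAR]
  have dy0 : ∀ t ∈ Ico 0 T, HasDerivWithinAt y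
      (A *ᵥ y t - (R * P t) *ᵥ x t) (Ici t) t := by
    intro t ht
    refine rd_fwd hh hTK hT (Φ := fun k s => A *ᵥ y s - (R * P s) *ᵥ x s)
      (f := fun s => A *ᵥ y s - (R * P s) *ᵥ x s) ?_ ?_ hy ht
    · intro k _
      exact (cMulVec continuousOn_const yc).sub (cMulVec (cMul continuousOn_const Pc) xc)
    · intro s _; rfl
  have dP0 : ∀ t ∈ Ico 0 T, HasDerivWithinAt P
      (-((AR As S p h ω t)ᵀ * P t + P t * AR As S p h ω t - P t * R * P t + Q)) (Ici t) t := by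
    intro t ht
    refine rd_bwd hh hTK hT (Φ := fun k s => (aM As S p ω k)ᵀ * P s + P s * aM As S p ω k
        - P s * R * P s + Q)
      (f := fun s => (AR As S p h ω s)ᵀ * P s + P s * AR As S p h ω s - P s * R * P s + Q)
      ?_ ?_ hP ht
    · intro k _
      exact (((cMul continuousOn_const Pc).add (cMul Pc continuousOn_const)).sub
        (cMul (cMul Pc continuousOn_const) Pc)).add continuousOn_const
    · intro s _; simp only [hAR]
  have dx : ∀ t ∈ Ico 0 T, HasDerivWithinAt (fun t => vL n (x t))
      (sq (fun i => clm (batchM As S p i)) ω ⌊t / h⌋₊ (vL n (x t)) -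
        clm R (clm (P t) (vL n (x t)))) (Ici t) t := by
    intro t ht
    have := (vL n).hasFDerivAt.comp_hasDerivWithinAt t (dx0 t ht)
    refine this.congr_deriv ?_
    rw [← hAt t ht, ← clm_vL, clm_sub, _root_.sub_apply, clm_mul]
  have dy : ∀ t ∈ Ico 0 T, HasDerivWithinAt (fun t => vL n (y t))
      (clm A (vL n (y t)) - clm R (clm (P t) (vL n (x t)))) (Ici t) t := by
    intro t ht
    have := (vL n).hasFDerivAt.comp_hasDerivWithinAt t (dy0 t ht)
    refine this.congr_deriv ?_
    rw [map_sub, ← clm_vL, ← clm_vL, clm_mul]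
  refine
    { hh := hh, hT := hTK, hT0 := hT, hμ0 := hμ0, hμ := ?_, Ss := clm_sym hR0, Qs := clm_sym hQ
      Fs := clm_sym hF, S0 := clm_psd hR0, Q0 := clm_psd hQ, F0 := clm_psd hF
      xc := cx, lc := cP.clm_apply cx, yc := cy, pc := cPT.clm_apply cy
      Gc := cPT.clm_comp continuousOn_const, Gb := ?_, xd := dx, ld := ?_, yd := dy, pd := ?_
      lT := ?_, pT := ?_, xy := ?_ }
  · intro k v
    unfold sq
    split_ifs
    · exact hμ _ v
    · simp; positivity
  · intro t ht
    exact (ContinuousLinearMap.opNorm_comp_le _ _).trans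
      (mul_le_mul_of_nonneg_right (hPTκ t ht) (norm_nonneg _))
  · intro t ht
    have d1 : HasDerivWithinAt (fun t => clm (P t)) (clm (-((AR As S p h ω t)ᵀ * P t +
        P t * AR As S p h ω t - P t * R * P t + Q))) (Ici t) t :=
      (clmL n n).hasFDerivAt.comp_hasDerivWithinAt t (dP0 t ht)
    refine (HasDerivWithinAt.clm_apply d1 (dx t ht)).congr_deriv ?_
    simp only [← hAt t ht, clm_neg, clm_add, clm_sub, clm_tr, clm_mul,
      _root_.neg_apply, _root_.add_apply, _root_.sub_apply, map_sub]
    abel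
  · intro t ht
    have d1 : HasDerivWithinAt (fun t => clm (PT t))
        (clm (-(Aᵀ * PT t + PT t * A - PT t * R * PT t + Q))) (Ici t) t :=
      (clmL n n).hasFDerivAt.comp_hasDerivWithinAt t
      ((hPT t ⟨ht.1, ht.2.le⟩).hasDerivWithinAt (s := Ici t))
    refine (HasDerivWithinAt.clm_apply d1 (dy t ht)).congr_deriv ?_
    simp only [clm_neg, clm_add, clm_sub, clm_tr, clm_mul,
      _root_.neg_apply, _root_.add_apply, _root_.sub_apply, map_sub, ContinuousLinearMap.comp_apply]
    abel
  · have := hP T ⟨hT.le, le_rfl⟩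
    rw [intervalIntegral.integral_same, add_zero] at this
    simp only [this]
  · simp only [hPTF]
  · have h1 := hx 0 ⟨le_rfl, hT.le⟩
    have h2 := hy 0 ⟨le_rfl, hT.le⟩
    rw [intervalIntegral.integral_same, add_zero] at h1 h2
    simp only [h1, h2]

end
end FB


/-- Bound on the expected feedback mismatch
`g(ω,t) = W⁻¹BᵀP_T(t) y(ω,t) − W⁻¹BᵀP_R(ω,t) x*(ω,t)`:
`E[|g(·,t)|] ≤ C_T e^{μ_R(2T+τ)} √(h Var[A_R]) |x̄|` for `t ∈ [0,τ]`. -/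
theorem feedback_mismatch_estimate
    (n m : ℕ) (A : Matrix (Fin n) (Fin n) ℝ) (B : Matrix (Fin n) (Fin m) ℝ)
    (Q : Matrix (Fin n) (Fin n) ℝ) (W : Matrix (Fin m) (Fin m) ℝ)
    (F : Matrix (Fin n) (Fin n) ℝ)
    (hQ : Q.PosSemidef) (hW : W.PosDef) (hF : F.PosSemidef)
    (T : ℝ) (hT : 0 < T) (κ : ℝ) (hκ : 0 < κ)
    (PT : ℝ → Matrix (Fin n) (Fin n) ℝ)
    (hPT : ∀ t ∈ Icc (0 : ℝ) T,
      HasDerivAt PT (-(Aᵀ * PT t + PT t * A - PT t * B * W⁻¹ * Bᵀ * PT t + Q)) t)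
    (hPTF : PT T = F)
    (hPTκ : ∀ t ∈ Icc (0 : ℝ) T, opN (PT t) ≤ κ) :
    ∃ C : ℝ, 0 < C ∧
      ∀ (M K : ℕ) (As : Fin M → Matrix (Fin n) (Fin n) ℝ)
        (S : Fin (2 ^ M) → Finset (Fin M)) (p : Fin (2 ^ M) → ℝ) (h : ℝ) (μR : ℝ),
        A = ∑ j, As j →
        Function.Bijective S →
        (∀ ω, 0 ≤ p ω ∧ p ω ≤ 1) → (∑ ω, p ω) = 1 →
        (∀ i, 0 < piP S p i) →
        0 < h → T = K * h →
        0 ≤ μR →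
        (∀ (ω : Fin K → Fin (2 ^ M)) (t : ℝ), t ∈ Icc (0 : ℝ) T →
          ∀ x : Fin n → ℝ, x ⬝ᵥ (AR As S p h ω t *ᵥ x) ≤ μR * (eN x) ^ 2) →
        h * varAR A As S p ≤ 1 →
        ∀ PR : (Fin K → Fin (2 ^ M)) → ℝ → Matrix (Fin n) (Fin n) ℝ,
          (∀ ω, ContinuousOn (PR ω) (Icc 0 T)) →
          (∀ ω, ∀ t ∈ Icc (0 : ℝ) T,
            PR ω t = F + ∫ s in t..T, ((AR As S p h ω s)ᵀ * PR ω s + PR ω s * AR As S p h ω s -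
              PR ω s * B * W⁻¹ * Bᵀ * PR ω s + Q)) →
          ∀ (τ : ℝ), 0 < τ → τ ≤ T →
            ∀ (xb : Fin n → ℝ) (xstar y : (Fin K → Fin (2 ^ M)) → ℝ → Fin n → ℝ),
              (∀ ω, ContinuousOn (xstar ω) (Icc 0 T)) →
              (∀ ω, ∀ t ∈ Icc (0 : ℝ) T,
                xstar ω t = xb + ∫ s in (0 : ℝ)..t,
                  ((AR As S p h ω s - B * W⁻¹ * Bᵀ * PR ω s) *ᵥ xstar ω s)) →
              (∀ ω, ContinuousOn (y ω) (Icc 0 T)) →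
              (∀ ω, ∀ t ∈ Icc (0 : ℝ) T,
                y ω t = xb + ∫ s in (0 : ℝ)..t,
                  (A *ᵥ y ω s - (B * W⁻¹ * Bᵀ * PR ω s) *ᵥ xstar ω s)) →
              ∀ t ∈ Icc (0 : ℝ) τ,
                expec p (fun ω =>
                    eN ((W⁻¹ * Bᵀ * PT t) *ᵥ y ω t - (W⁻¹ * Bᵀ * PR ω t) *ᵥ xstar ω t)) ≤
                  C * Real.exp (μR * (2 * T + τ)) * Real.sqrt (h * varAR A As S p) * eN xb := by
  have hg : 0 ≤ κ * ‖clm (B * W⁻¹ * Bᵀ)‖ := by positivity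
  have hcR : 0 ≤ FB.cR (clm A) (clm (B * W⁻¹ * Bᵀ)) (clm Q) (clm F) T
      (κ * ‖clm (B * W⁻¹ * Bᵀ)‖) := by
    have hT' := hT.le
    unfold FB.cR
    positivity
  set c := FB.cR (clm A) (clm (B * W⁻¹ * Bᵀ)) (clm Q) (clm F) T
      (κ * ‖clm (B * W⁻¹ * Bᵀ)‖) with hc
  refine ⟨‖clm (W⁻¹ * Bᵀ)‖ * c + 1, by positivity, ?_⟩
  intro M K As S p h μR hA _ hp hp1 hpi hh hTK hμ0 hμ hV PR PRc hPR τ hτ hτT xb xstar y xc hx yc hy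
    t ht
  have hK : 0 < K := by
    rcases Nat.eq_zero_or_pos K with h0 | h0
    · subst h0; simp at hTK; linarith
    · exact h0
  have hμ' : ∀ i x, inner ℝ (clm (batchM As S p i) x) x ≤ μR * ‖x‖ ^ 2 := by
    intro i x
    obtain ⟨v, rfl⟩ := FB.vL_surj x
    have := hμ (fun _ => i) 0 ⟨le_rfl, hT.le⟩ v
    rw [AR, dif_pos hK] at this
    rwa [FB.clm_vL, FB.inner_vL, ← FB.eN_eq]
  have H := fun ω => FB.sys hQ hW hF hT hPT hPTF hPTκ hh hTK hμ0 hμ' ω (PRc ω) (hPR ω)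
    (xc ω) (hx ω) (yc ω) (hy ω)
  have hmean : ∑ i, p i • clm (batchM As S p i) = clm A := by
    have h1 := congrArg (FB.clmL n n) (FB.mean_batch As S p hpi)
    rw [map_sum, ← hA] at h1
    exact (Finset.sum_congr rfl fun i _ => (map_smul (FB.clmL n n) (p i) _).symm).trans h1
  have hvar : varAR A As S p = ∑ i, p i * ‖clm A - clm (batchM As S p i)‖ ^ 2 := by
    simp only [varAR, opN, FB.clm_sub]
  have hx0 : ∀ ω, FB.vL n (xstar ω 0) = FB.vL n xb := by
    intro ω
    have h1 := hx ω 0 ⟨le_rfl, hT.le⟩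
    rw [intervalIntegral.integral_same, add_zero] at h1
    rw [h1]
  have main := FB.core (t := t) (fun i => (hp i).1) hp1 hmean hμ0 hμ' hh (hvar ▸ hV) hTK hT H hx0
    ⟨ht.1, ht.2.trans hτT⟩ hg
  rw [← hvar, ← FB.eN_eq, ← hc] at main
  have hb : expec p (fun ω =>
      eN ((W⁻¹ * Bᵀ * PT t) *ᵥ y ω t - (W⁻¹ * Bᵀ * PR ω t) *ᵥ xstar ω t)) ≤
      ‖clm (W⁻¹ * Bᵀ)‖ * FB.Ex p (fun ω => ‖clm (PT t) (FB.vL n (y ω t)) -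
        clm (PR ω t) (FB.vL n (xstar ω t))‖) := by
    unfold expec FB.Ex
    rw [Finset.mul_sum]
    refine Finset.sum_le_sum fun ω _ => ?_
    have h0 : 0 ≤ ∏ k, p (ω k) := Finset.prod_nonneg fun k _ => (hp _).1
    have h1 : eN ((W⁻¹ * Bᵀ * PT t) *ᵥ y ω t - (W⁻¹ * Bᵀ * PR ω t) *ᵥ xstar ω t) ≤
        ‖clm (W⁻¹ * Bᵀ)‖ * ‖clm (PT t) (FB.vL n (y ω t)) -
        clm (PR ω t) (FB.vL n (xstar ω t))‖ := by
      rw [FB.eN_eq, map_sub, ← FB.clm_vL, ← FB.clm_vL, FB.clm_mul (W⁻¹ * Bᵀ),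
        FB.clm_mul (W⁻¹ * Bᵀ), ← map_sub]
      exact ContinuousLinearMap.le_opNorm _ _
    calc _ ≤ (∏ k, p (ω k)) * (‖clm (W⁻¹ * Bᵀ)‖ * ‖clm (PT t) (FB.vL n (y ω t)) -
        clm (PR ω t) (FB.vL n (xstar ω t))‖) := mul_le_mul_of_nonneg_left h1 h0
      _ = _ := by ring
  have he : Real.exp (2 * μR * T) ≤ Real.exp (μR * (2 * T + τ)) := by
    apply Real.exp_le_exp.2
    nlinarith [mul_nonneg hμ0 hτ.le]
  have hn : 0 ≤ eN xb := Real.sqrt_nonneg _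
  refine hb.trans ((mul_le_mul_of_nonneg_left main (norm_nonneg _)).trans ?_)
  calc ‖clm (W⁻¹ * Bᵀ)‖ * (c * (Real.exp (2 * μR * T) * √(h * varAR A As S p) * eN xb))
      = (‖clm (W⁻¹ * Bᵀ)‖ * c) * Real.exp (2 * μR * T) * √(h * varAR A As S p) * eN xb := by ring
    _ ≤ (‖clm (W⁻¹ * Bᵀ)‖ * c + 1) * Real.exp (μR * (2 * T + τ)) *
        √(h * varAR A As S p) * eN xb := by
      gcongr
      linarith
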